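/- arXiv:1406.2520 — 3 statements merged into one kernel-verified Lean document; each statement's English description precedes it below -/
import Mathlib

section
/- Let Y = (Y_1, …, Y_d) be a centered Gaussian random vector in R^d with E[Y_i] = 0 and E[Y_i^2] = 1 for all i, and let C = (E[Y_i Y_j])_{i,j} be its correlation matrix. Let c^- and c^+ denote the smallest and largest eigenvalues of C. Then for all measurable functions φ_i : R → R with E[φ_i(Y_i)] = 0 and φ_i(Y_i) square-integrable (i = 1, …, d), one has c^- · Σ_{i=1}^d ‖φ_i(Y_i)‖_2^2 ≤ ‖Σ_{i=1}^d φ_i(Y_i)‖_2^2 ≤ c^+ · Σ_{i=1}^d ‖φ_i(Y_i)‖_2^2. -/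
open MeasureTheory ProbabilityTheory
open scoped NNReal

/-- `Y` is a jointly centered Gaussian random vector: every linear combination of its
coordinates has a centered Gaussian law. -/
def IsCenteredGaussianVec {Ω : Type*} [MeasurableSpace Ω] (μ : Measure Ω) {d : ℕ}
    (Y : Ω → Fin d → ℝ) : Prop :=
  ∀ c : Fin d → ℝ, ∃ v : ℝ≥0,
    Measure.map (fun ω => ∑ i, c i * Y ω i) μ = gaussianReal 0 v

open Matrix in
/-- A real symmetric matrix is positive semidefinite if all its eigenvalues are nonnegative. -/
theorem posSemidef_of_forall_eigenvalue_nonneg {n : Type*} [Fintype n]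
    {A : Matrix n n ℝ} (hA : A.IsHermitian)
    (h : ∀ (lam : ℝ) (v : n → ℝ), v ≠ 0 → A *ᵥ v = lam • v → 0 ≤ lam) : A.PosSemidef := by
  classical
  rw [hA.posSemidef_iff_eigenvalues_nonneg]
  intro i
  refine h _ _ ?_ (hA.mulVec_eigenvectorBasis i)
  have h0 := hA.eigenvectorBasis.orthonormal.ne_zero i
  contrapose! h0
  ext j
  exact congrFun h0 j

open Matrix in
/-- A quadratic form `p xᵀ C x + q xᵀ x` that is nonnegative stays nonnegative when `C`, positive
semidefinite with unit diagonal, is replaced by one of its entrywise powers. -/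
theorem entrywise_pow_quadratic_nonneg {n : Type*} [Fintype n] [DecidableEq n]
    {C : Matrix n n ℝ} (hC : C.PosSemidef) (hdiag : ∀ i, C i i = 1) {p q : ℝ}
    (hpq : (p • C + q • (1 : Matrix n n ℝ)).PosSemidef) (k : ℕ) (x : n → ℝ) :
    0 ≤ p * ∑ i, ∑ j, C i j ^ (k + 1) * (x i * x j) + q * ∑ i, x i ^ 2 := by
  have key : ∀ k : ℕ, (Matrix.of fun i j => C i j ^ k *
      (p • C + q • (1 : Matrix n n ℝ)) i j).PosSemidef := by
    intro k
    induction k with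
    | zero =>
      convert hpq using 1
      ext i j
      simp
    | succ k ih =>
      convert! hC.hadamard ih using 1
      ext i j
      simp [pow_succ]
      ring
  have hx := (key k).dotProduct_mulVec_nonneg x
  refine hx.trans_eq ?_
  symm
  simp only [dotProduct, mulVec, Finset.mul_sum, star_trivial]
  rw [← Finset.sum_add_distrib]
  refine Finset.sum_congr rfl fun i _ => ?_
  have hi : q * x i ^ 2 = ∑ j, x i * (C i j ^ k * (q * (1 : Matrix n n ℝ) i j) * x j) := by
    rw [Finset.sum_eq_single i]
    · simp [hdiag]; ring
    · intro j _ hj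
      simp [Matrix.one_apply_ne hj.symm]
    · simp
  rw [hi, ← Finset.sum_add_distrib]
  refine Finset.sum_congr rfl fun j _ => ?_
  simp only [of_apply, Matrix.add_apply, Matrix.smul_apply, smul_eq_mul]
  ring

/-- The exponential series without its constant term. -/
theorem hasSum_exp_sub_one (x : ℝ) :
    HasSum (fun k : ℕ => x ^ (k + 1) / (k + 1).factorial) (Real.exp x - 1) := by
  have h := NormedSpace.expSeries_div_hasSum_exp (𝔸 := ℝ) x
  rw [← Real.exp_eq_exp_ℝ] at h
  rw [← hasSum_nat_add_iff' 1] at h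
  simpa using h

/-- If the images of a total family `E` under continuous linear maps `L i` have Gram kernels
`exp (s * t * C i j) - 1`, then quadratic form bounds for `C` pass to the family `L`. -/
theorem quadratic_nonneg_of_exp_kernel {H K ι : Type*} [Fintype ι] [DecidableEq ι]
    [NormedAddCommGroup H] [NormedSpace ℝ H]
    [NormedAddCommGroup K] [InnerProductSpace ℝ K] (L : ι → H →L[ℝ] K) (E : ℝ → H)
    (hE : Dense (Submodule.span ℝ (Set.range E) : Set H))
    {C : Matrix ι ι ℝ} (hC : C.PosSemidef) (hdiag : ∀ i, C i i = 1)
    (hinner : ∀ i j s t, inner ℝ (L i (E s)) (L j (E t)) = Real.exp (s * t * C i j) - 1)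
    {p q : ℝ} (hpq : (p • C + q • (1 : Matrix ι ι ℝ)).PosSemidef) (f : ι → H) :
    0 ≤ p * ‖∑ i, L i (f i)‖ ^ 2 + q * ∑ i, ‖L i (f i)‖ ^ 2 := by
  have hclosed : IsClosed {f : ι → H | 0 ≤ p * ‖∑ i, L i (f i)‖ ^ 2 + q * ∑ i, ‖L i (f i)‖ ^ 2} :=
    isClosed_le continuous_const (by fun_prop)
  have hdense := dense_pi Set.univ (fun (_ : ι) _ => hE)
  refine hclosed.closure_subset_iff.mpr ?_ (hdense f)
  intro f hf
  have hf' : ∀ i, ∃ c : ℝ →₀ ℝ, (c.sum fun a r => r • E a) = f i := fun i =>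
    Finsupp.mem_span_range_iff_exists_finsupp.mp (hf i (Set.mem_univ i))
  choose α hα using hf'
  set A : ι → ℕ → ℝ := fun i k => (α i).sum fun a r => r * a ^ k with hA
  have hB : ∀ i j, HasSum (fun k : ℕ => C i j ^ (k + 1) * (A i (k + 1) * A j (k + 1)) /
      (k + 1).factorial) (inner ℝ (L i (f i)) (L j (f j))) := by
    intro i j
    have h1 : inner ℝ (L i (f i)) (L j (f j)) = ∑ a ∈ (α i).support, ∑ b ∈ (α j).support,
        α i a * α j b * (Real.exp (a * b * C i j) - 1) := by
      rw [← hα i, ← hα j]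
      simp only [Finsupp.sum, map_sum, map_smul, sum_inner, inner_sum, real_inner_smul_left,
        real_inner_smul_right, hinner]
      rw [Finset.sum_comm]
      refine Finset.sum_congr rfl fun a _ => Finset.sum_congr rfl fun b _ => ?_
      ring
    rw [h1]
    have h2 := hasSum_sum (s := (α i).support) fun a _ => hasSum_sum (s := (α j).support)
      fun b _ => (hasSum_exp_sub_one (a * b * C i j)).mul_left (α i a * α j b)
    convert! h2 using 1
    ext k
    simp only [hA, Finsupp.sum]
    rw [Finset.sum_mul_sum]
    simp only [Finset.mul_sum, Finset.sum_div]
    refine Finset.sum_congr rfl fun a _ => Finset.sum_congr rfl fun b _ => ?_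
    ring
  have h3 : ‖∑ i, L i (f i)‖ ^ 2 = ∑ i, ∑ j, inner ℝ (L i (f i)) (L j (f j)) := by
    rw [← real_inner_self_eq_norm_sq]
    simp_rw [sum_inner, inner_sum]
  have h4 := ((hasSum_sum (s := Finset.univ) fun i _ => hasSum_sum (s := Finset.univ)
    fun j _ => hB i j).mul_left p).add
    ((hasSum_sum (s := Finset.univ) fun i _ => hB i i).mul_left q)
  simp only [real_inner_self_eq_norm_sq] at h4
  rw [← h3] at h4
  refine h4.nonneg fun k => ?_
  have h5 := entrywise_pow_quadratic_nonneg hC hdiag hpq k fun i => A i (k + 1)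
  simp only [← Finset.sum_div, hdiag, one_pow, one_mul, ← sq]
  rw [mul_div_assoc', mul_div_assoc', ← add_div]
  positivity

/-- A function whose two-sided Laplace transform exists and vanishes on `ℝ` is zero a.e. -/
theorem ae_eq_zero_of_integral_exp_mul_eq_zero {ν : Measure ℝ} [SigmaFinite ν] {f : ℝ → ℝ}
    (hf : Measurable f) (hint : ∀ s, Integrable (fun x => Real.exp (s * x) * f x) ν)
    (hzero : ∀ s, ∫ x, Real.exp (s * x) * f x ∂ν = 0) : f =ᵐ[ν] 0 := by
  have hfint : Integrable f ν := by simpa using hint 0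
  have hexp : ∀ g : ℝ → ℝ, (∀ s, Integrable (fun x => Real.exp (s * x) * g x) ν) →
      Measurable g → ∀ s,
      Integrable (fun x => Real.exp (s * id x)) (ν.withDensity fun x => ENNReal.ofReal (g x)) := by
    intro g hg hgm s
    rw [integrable_withDensity_iff_integrable_smul' (by fun_prop) (by simp)]
    refine (hg s).pos_part.congr (.of_forall fun x => ?_)
    simp only [ENNReal.toReal_ofReal', smul_eq_mul, id]
    rw [mul_comm (max _ _), mul_max_of_nonneg _ _ (Real.exp_pos _).le, mul_zero]
  have hmgf : ∀ (g : ℝ → ℝ), Measurable g → ∀ s,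
      mgf id (ν.withDensity fun x => ENNReal.ofReal (g x)) s
        = ∫ x, Real.exp (s * x) * max (g x) 0 ∂ν := by
    intro g hgm s
    rw [mgf, integral_withDensity_eq_integral_toReal_smul (by fun_prop) (by simp)]
    simp [ENNReal.toReal_ofReal', mul_comm]
  have hneg : ∀ s, Integrable (fun x => Real.exp (s * x) * (-f) x) ν := fun s => by
    simpa using (hint s).neg
  set μ₁ := ν.withDensity fun x => ENNReal.ofReal (f x) with hμ₁
  set μ₂ := ν.withDensity fun x => ENNReal.ofReal ((-f) x) with hμ₂
  have : IsFiniteMeasure μ₁ := isFiniteMeasure_withDensity_ofReal hfint.2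
  have : IsFiniteMeasure μ₂ := isFiniteMeasure_withDensity_ofReal hfint.neg.2
  have hmm : mgf id μ₁ = mgf id μ₂ := by
    ext s
    rw [hmgf f hf, hmgf (-f) hf.neg, ← sub_eq_zero, ← integral_sub]
    · refine (integral_congr_ae (.of_forall fun x => ?_)).trans (hzero s)
      simp only [Pi.neg_apply, ← mul_sub, max_zero_sub_eq_self]
    · refine (hint s).pos_part.congr (.of_forall fun x => ?_)
      simp only
      rw [mul_max_of_nonneg _ _ (Real.exp_pos _).le, mul_zero]
    · refine (hneg s).pos_part.congr (.of_forall fun x => ?_)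
      simp only
      rw [mul_max_of_nonneg _ _ (Real.exp_pos _).le, mul_zero]
  have hiff : μ₁ = 0 ↔ μ₂ = 0 := by
    have h0 := congrFun hmm 0
    simp only [mgf_zero'] at h0
    rw [← Measure.measure_univ_eq_zero, ← Measure.measure_univ_eq_zero,
      ← measureReal_eq_zero_iff, ← measureReal_eq_zero_iff, h0]
  have huniv : integrableExpSet id μ₁ = Set.univ := by
    ext s
    simpa [integrableExpSet] using hexp f hint hf s
  have heq : μ₁ = μ₂ := by
    refine Measure.ext_of_complexMGF_id_eq (funext fun z => ?_)
    exact eqOn_complexMGF_of_mgf' hmm hiff (by simp [huniv])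
  rw [hμ₁, hμ₂, withDensity_eq_iff_of_sigmaFinite (by fun_prop) (by fun_prop)] at heq
  filter_upwards [heq] with x hx
  rcases le_total 0 (f x) with h | h
  · simpa [ENNReal.ofReal_of_nonpos (neg_nonpos.mpr h), h.ge_iff_eq'] using hx
  · have h' := hx.symm
    simp only [Pi.neg_apply, ENNReal.ofReal_of_nonpos h, ENNReal.ofReal_eq_zero] at h'
    exact le_antisymm h (by simpa using h')

/-- The inner product of `L²` classes of real functions. -/
theorem inner_toLp_real {α : Type*} [MeasurableSpace α] {ν : Measure α} {f g : α → ℝ}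
    (hf : MemLp f 2 ν) (hg : MemLp g 2 ν) :
    inner ℝ (hf.toLp f) (hg.toLp g) = ∫ x, f x * g x ∂ν := by
  rw [L2.inner_def]
  refine integral_congr_ae ?_
  filter_upwards [hf.coeFn_toLp, hg.coeFn_toLp] with x h1 h2
  simp [h1, h2, mul_comm]

/-- The functions `x ↦ exp (s x - s² / 2)` are square-integrable for the standard Gaussian law. -/
theorem memLp_exp_gaussianReal (s : ℝ) :
    MemLp (fun x => Real.exp (s * x - s ^ 2 / 2)) 2 (gaussianReal 0 1) := by
  rw [memLp_two_iff_integrable_sq (by fun_prop)]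
  refine ((integrable_exp_mul_gaussianReal (μ := 0) (v := 1) (2 * s)).mul_const
    (Real.exp (-s ^ 2))).congr (.of_forall fun x => ?_)
  simp only
  rw [← Real.exp_add, ← Real.exp_nat_mul]
  congr 1
  push_cast
  ring

/-- The normalized exponential `x ↦ exp (s x - s² / 2)` as an element of Gaussian `L²`. -/
noncomputable def gaussianExp (s : ℝ) : Lp ℝ 2 (gaussianReal 0 1) :=
  (memLp_exp_gaussianReal s).toLp _

/-- Normalized exponentials span a dense subspace of Gaussian `L²`. -/
theorem dense_span_gaussianExp :
    Dense (Submodule.span ℝ (Set.range gaussianExp) : Set (Lp ℝ 2 (gaussianReal 0 1))) := by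
  rw [Submodule.dense_iff_topologicalClosure_eq_top, Submodule.topologicalClosure_eq_top_iff,
    Submodule.eq_bot_iff]
  intro f hf
  have hmul : ∀ s, Integrable (fun x => Real.exp (s * x - s ^ 2 / 2) * f x) (gaussianReal 0 1) :=
    fun s => (memLp_exp_gaussianReal s).integrable_mul (Lp.memLp f)
  have hrw : ∀ s x, Real.exp (s * x) * f x
      = Real.exp (s ^ 2 / 2) * (Real.exp (s * x - s ^ 2 / 2) * f x) := by
    intro s x
    rw [← mul_assoc, ← Real.exp_add]
    congr 2
    ring
  rw [Lp.eq_zero_iff_ae_eq_zero]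
  refine ae_eq_zero_of_integral_exp_mul_eq_zero (Lp.stronglyMeasurable f).measurable
    (fun s => ?_) (fun s => ?_)
  · simp_rw [hrw]
    exact (hmul s).const_mul _
  · simp_rw [hrw]
    rw [integral_const_mul]
    have h := (Submodule.mem_orthogonal _ _).mp hf (gaussianExp s)
      (Submodule.subset_span ⟨s, rfl⟩)
    have h2 := inner_toLp_real (memLp_exp_gaussianReal s) (Lp.memLp f)
    rw [Lp.toLp_coeFn] at h2
    rw [← h2]
    change _ * inner ℝ (gaussianExp s) f = 0
    rw [h, mul_zero]

theorem IsCenteredGaussianVec.aemeasurable {Ω : Type*} [MeasurableSpace Ω] {μ : Measure Ω} {d : ℕ}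
    {Y : Ω → Fin d → ℝ} (hY : IsCenteredGaussianVec μ Y) (c : Fin d → ℝ) :
    AEMeasurable (fun ω => ∑ i, c i * Y ω i) μ := by
  obtain ⟨v, hv⟩ := hY c
  exact aemeasurable_of_map_neZero (by rw [hv]; infer_instance)

theorem IsCenteredGaussianVec.memLp {Ω : Type*} [MeasurableSpace Ω] {μ : Measure Ω} {d : ℕ}
    {Y : Ω → Fin d → ℝ} (hY : IsCenteredGaussianVec μ Y) (c : Fin d → ℝ) :
    MemLp (fun ω => ∑ i, c i * Y ω i) 2 μ := by
  obtain ⟨v, hv⟩ := hY c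
  have h : MemLp id 2 (gaussianReal 0 v) := memLp_id_gaussianReal 2
  rw [← hv] at h
  exact h.comp_of_map (hY.aemeasurable c)

/-- A centered Gaussian variable satisfies `E[exp X] = exp (E[X²] / 2)`. -/
theorem IsCenteredGaussianVec.integral_exp {Ω : Type*} [MeasurableSpace Ω] {μ : Measure Ω}
    {d : ℕ} {Y : Ω → Fin d → ℝ} (hY : IsCenteredGaussianVec μ Y) (c : Fin d → ℝ) :
    ∫ ω, Real.exp (∑ i, c i * Y ω i) ∂μ
      = Real.exp ((∫ ω, (∑ i, c i * Y ω i) ^ 2 ∂μ) / 2) := by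
  obtain ⟨v, hv⟩ := hY c
  have h1 := mgf_gaussianReal hv 1
  have h2 : ∫ ω, (∑ i, c i * Y ω i) ^ 2 ∂μ = v := by
    have h3 := integral_map (hY.aemeasurable c) (f := fun x : ℝ => x ^ 2)
      (by fun_prop)
    rw [← h3, hv]
    have h4 := variance_id_gaussianReal (μ := 0) (v := v)
    rw [variance_of_integral_eq_zero aemeasurable_id (by simp)] at h4
    exact h4
  rw [h2]
  simpa [mgf] using h1

/-- The variable `Y i` has the standard Gaussian law if `E[(Y i)²] = 1`. -/
theorem IsCenteredGaussianVec.map_apply_eq {Ω : Type*} [MeasurableSpace Ω] {μ : Measure Ω}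
    {d : ℕ} {Y : Ω → Fin d → ℝ} (hY : IsCenteredGaussianVec μ Y) {i : Fin d}
    (hvar : ∫ ω, (Y ω i) ^ 2 ∂μ = 1) : μ.map (fun ω => Y ω i) = gaussianReal 0 1 := by
  have hsum : (fun ω => ∑ j, (Pi.single i 1 : Fin d → ℝ) j * Y ω j) = fun ω => Y ω i := by
    ext ω
    simp [Pi.single_apply]
  obtain ⟨v, hv⟩ := hY (Pi.single i 1)
  have hm := hY.aemeasurable (Pi.single i 1)
  rw [hsum] at hv hm
  have h3 := integral_map hm (f := fun x : ℝ => x ^ 2) (by fun_prop)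
  have h4 := variance_id_gaussianReal (μ := 0) (v := v)
  rw [variance_of_integral_eq_zero aemeasurable_id (by simp)] at h4
  rw [hvar, hv] at h3
  have hv1 : (v : ℝ) = 1 := h4.symm.trans h3
  rw [hv, NNReal.coe_eq_one.mp hv1]

/-- Normalized exponentials of the coordinates of a standardized Gaussian vector have the Gram
kernel `exp (s * t * E[Y i * Y j])`. -/
theorem IsCenteredGaussianVec.integral_exp_mul_exp {Ω : Type*} [MeasurableSpace Ω]
    {μ : Measure Ω} {d : ℕ} {Y : Ω → Fin d → ℝ} (hY : IsCenteredGaussianVec μ Y)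
    (hL : ∀ i, MemLp (fun ω => Y ω i) 2 μ) (hvar : ∀ i, ∫ ω, (Y ω i) ^ 2 ∂μ = 1)
    (i j : Fin d) (s t : ℝ) :
    ∫ ω, Real.exp (s * Y ω i - s ^ 2 / 2) * Real.exp (t * Y ω j - t ^ 2 / 2) ∂μ
      = Real.exp (s * t * ∫ ω, Y ω i * Y ω j ∂μ) := by
  have hsum : ∀ ω, ∑ k, (Pi.single i s + Pi.single j t : Fin d → ℝ) k * Y ω k
      = s * Y ω i + t * Y ω j := by
    intro ω
    simp [Pi.single_apply, add_mul, Finset.sum_add_distrib]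
  have h1 := hY.integral_exp (Pi.single i s + Pi.single j t)
  simp_rw [hsum] at h1
  have h2 : ∫ ω, (s * Y ω i + t * Y ω j) ^ 2 ∂μ
      = s ^ 2 + t ^ 2 + 2 * (s * t * ∫ ω, Y ω i * Y ω j ∂μ) := by
    have hi := (hL i).integrable_sq.const_mul (s ^ 2)
    have hj := (hL j).integrable_sq.const_mul (t ^ 2)
    have hij : Integrable (fun ω => 2 * s * t * (Y ω i * Y ω j)) μ :=
      ((hL i).integrable_mul (hL j)).const_mul (2 * s * t)
    have hadd : Integrable (fun ω => s ^ 2 * Y ω i ^ 2 + t ^ 2 * Y ω j ^ 2) μ := hi.add hj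
    have h3 : ∀ ω, (s * Y ω i + t * Y ω j) ^ 2
        = s ^ 2 * Y ω i ^ 2 + t ^ 2 * Y ω j ^ 2 + 2 * s * t * (Y ω i * Y ω j) := by
      intro ω
      ring
    simp_rw [h3]
    rw [integral_add hadd hij, integral_add hi hj, integral_const_mul, integral_const_mul,
      integral_const_mul, hvar, hvar]
    ring
  have h4 : ∀ ω, Real.exp (s * Y ω i - s ^ 2 / 2) * Real.exp (t * Y ω j - t ^ 2 / 2)
      = Real.exp (-(s ^ 2 + t ^ 2) / 2) * Real.exp (s * Y ω i + t * Y ω j) := by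
    intro ω
    rw [← Real.exp_add, ← Real.exp_add]
    congr 1
    ring
  simp_rw [h4]
  rw [integral_const_mul, h1, h2, ← Real.exp_add]
  congr 1
  ring

open Matrix in
/-- The matrix of second moments of square-integrable variables is positive semidefinite. -/
theorem posSemidef_integral_mul {Ω ι : Type*} [MeasurableSpace Ω] [Fintype ι] {μ : Measure Ω}
    {Y : Ω → ι → ℝ} (hL : ∀ i, MemLp (fun ω => Y ω i) 2 μ) :
    (Matrix.of fun i j => ∫ ω, Y ω i * Y ω j ∂μ).PosSemidef := by
  refine PosSemidef.of_dotProduct_mulVec_nonneg (Matrix.IsHermitian.ext fun i j => ?_) fun x => ?_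
  · simp [mul_comm]
  · have h : 0 ≤ ∫ ω, (∑ i, x i * Y ω i) ^ 2 ∂μ := integral_nonneg fun ω => sq_nonneg _
    have hij : ∀ i j, Integrable (fun ω => x i * x j * (Y ω i * Y ω j)) μ := fun i j =>
      ((hL i).integrable_mul (hL j)).const_mul _
    have h2 : ∀ ω, (∑ i, x i * Y ω i) ^ 2 = ∑ i, ∑ j, x i * x j * (Y ω i * Y ω j) := by
      intro ω
      rw [sq, Finset.sum_mul_sum]
      refine Finset.sum_congr rfl fun i _ => Finset.sum_congr rfl fun j _ => ?_
      ring
    simp_rw [h2] at h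
    rw [integral_finsetSum _ fun i _ => integrable_finsetSum _ fun j _ => hij i j] at h
    refine h.trans_eq (Finset.sum_congr rfl fun i _ => ?_)
    rw [integral_finsetSum _ fun j _ => hij i j]
    simp only [mulVec, dotProduct, of_apply, star_trivial, Finset.mul_sum, integral_const_mul]
    refine Finset.sum_congr rfl fun j _ => ?_
    ring

/-- A bound on a quadratic form of the correlation matrix of a standardized Gaussian vector passes
to centered square-integrable functions of its coordinates. -/
theorem IsCenteredGaussianVec.quadratic_nonneg {Ω : Type*} [MeasurableSpace Ω] {μ : Measure Ω}
    [IsProbabilityMeasure μ] {d : ℕ} {Y : Ω → Fin d → ℝ} (hY : IsCenteredGaussianVec μ Y)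
    (hvar : ∀ i, ∫ ω, (Y ω i) ^ 2 ∂μ = 1) (hL : ∀ i, MemLp (fun ω => Y ω i) 2 μ)
    {C : Matrix (Fin d) (Fin d) ℝ} (hC : ∀ i j, C i j = ∫ ω, Y ω i * Y ω j ∂μ)
    {p q : ℝ} (hpq : (p • C + q • (1 : Matrix (Fin d) (Fin d) ℝ)).PosSemidef)
    {φ : Fin d → ℝ → ℝ} (hmeas : ∀ i, Measurable (φ i))
    (hcent : ∀ i, ∫ ω, φ i (Y ω i) ∂μ = 0)
    (hL2 : ∀ i, Integrable (fun ω => (φ i (Y ω i)) ^ 2) μ) :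
    0 ≤ p * ∫ ω, (∑ i, φ i (Y ω i)) ^ 2 ∂μ + q * ∑ i, ∫ ω, (φ i (Y ω i)) ^ 2 ∂μ := by
  have hCpos : C.PosSemidef := by
    have h : C = Matrix.of fun i j => ∫ ω, Y ω i * Y ω j ∂μ := by ext i j; exact hC i j
    rw [h]
    exact posSemidef_integral_mul hL
  have hdiag : ∀ i, C i i = 1 := fun i => by rw [hC, ← hvar i]; simp_rw [sq]
  have haem : ∀ i, AEMeasurable (fun ω => Y ω i) μ := fun i =>
    (hL i).aestronglyMeasurable.aemeasurable
  set Z : Fin d → Ω → ℝ := fun i => (haem i).mk _ with hZ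
  have hYZ : ∀ i, (fun ω => Y ω i) =ᵐ[μ] Z i := fun i => (haem i).ae_eq_mk
  have hmp : ∀ i, MeasurePreserving (Z i) μ (gaussianReal 0 1) := fun i =>
    ⟨(haem i).measurable_mk, by rw [← Measure.map_congr (hYZ i), hY.map_apply_eq (hvar i)]⟩
  set T : Fin d → Lp ℝ 2 (gaussianReal 0 1) →ₗᵢ[ℝ] Lp ℝ 2 μ := fun i =>
    Lp.compMeasurePreservingₗᵢ ℝ (Z i) (hmp i) with hT
  have hTtoLp : ∀ i {g : ℝ → ℝ} (hg : MemLp g 2 (gaussianReal 0 1)),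
      T i (hg.toLp g) = (hg.comp_measurePreserving (hmp i)).toLp _ := fun i g hg => rfl
  have hTE : ∀ i j s t, inner ℝ (T i (gaussianExp s)) (T j (gaussianExp t))
      = Real.exp (s * t * C i j) := by
    intro i j s t
    rw [hC, ← hY.integral_exp_mul_exp hL hvar, gaussianExp, gaussianExp, hTtoLp, hTtoLp,
      inner_toLp_real]
    refine integral_congr_ae ?_
    filter_upwards [hYZ i, hYZ j] with ω hi hj
    simp [hi, hj]
  have h0E : ∀ (_ : Fin d) (s : ℝ), inner ℝ (gaussianExp 0) (gaussianExp s) = (1 : ℝ) := by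
    intro i s
    rw [← (T i).inner_map_map, hTE]
    simp
  set P : Lp ℝ 2 (gaussianReal 0 1) →L[ℝ] Lp ℝ 2 (gaussianReal 0 1) :=
    ContinuousLinearMap.id ℝ _ - (innerSL ℝ (gaussianExp 0)).smulRight (gaussianExp 0) with hP
  have hPapply : ∀ f, P f = f - inner ℝ (gaussianExp 0) f • gaussianExp 0 := fun f => by simp [hP]
  have hinner : ∀ i j s t,
      inner ℝ (((T i).toContinuousLinearMap.comp P) (gaussianExp s))
        (((T j).toContinuousLinearMap.comp P) (gaussianExp t)) = Real.exp (s * t * C i j) - 1 := by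
    intro i j s t
    simp only [ContinuousLinearMap.comp_apply, LinearIsometry.coe_toContinuousLinearMap, hPapply,
      h0E i, one_smul, map_sub, inner_sub_left, inner_sub_right, hTE]
    simp
  have hφ : ∀ i, MemLp (φ i) 2 (gaussianReal 0 1) := fun i => by
    rw [memLp_two_iff_integrable_sq (hmeas i).aestronglyMeasurable, ← hY.map_apply_eq (hvar i),
      integrable_map_measure (by fun_prop) (haem i)]
    exact hL2 i
  have hPφ : ∀ i, P ((hφ i).toLp _) = (hφ i).toLp _ := by
    intro i
    have h : inner ℝ (gaussianExp 0) ((hφ i).toLp _) = 0 := by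
      rw [gaussianExp, inner_toLp_real, ← hY.map_apply_eq (hvar i), integral_map (haem i)]
      · simpa using hcent i
      · fun_prop
    rw [hPapply, h, zero_smul, sub_zero]
  have key := quadratic_nonneg_of_exp_kernel _ gaussianExp dense_span_gaussianExp hCpos hdiag hinner
    hpq fun i => (hφ i).toLp _
  simp only [ContinuousLinearMap.comp_apply, LinearIsometry.coe_toContinuousLinearMap, hPφ,
    hTtoLp] at key
  have hsq : ∀ i, ‖((hφ i).comp_measurePreserving (hmp i)).toLp _‖ ^ 2
      = ∫ ω, (φ i (Y ω i)) ^ 2 ∂μ := by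
    intro i
    rw [← real_inner_self_eq_norm_sq, inner_toLp_real]
    refine integral_congr_ae ?_
    filter_upwards [hYZ i] with ω hi
    simp [hi, sq]
  have hsum : ‖∑ i, ((hφ i).comp_measurePreserving (hmp i)).toLp _‖ ^ 2
      = ∫ ω, (∑ i, φ i (Y ω i)) ^ 2 ∂μ := by
    have hmem := memLp_finsetSum' Finset.univ
      fun i (_ : i ∈ Finset.univ) => (hφ i).comp_measurePreserving (hmp i)
    have h : ∑ i, ((hφ i).comp_measurePreserving (hmp i)).toLp _ = hmem.toLp _ := by
      refine Lp.ext ?_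
      refine (Lp.coeFn_finsetSum _ _).trans ?_
      refine .trans ?_ hmem.coeFn_toLp.symm
      filter_upwards [ae_all_iff.mpr fun i =>
        ((hφ i).comp_measurePreserving (hmp i)).coeFn_toLp] with ω hω
      simp [hω]
    rw [h, ← real_inner_self_eq_norm_sq, inner_toLp_real]
    refine integral_congr_ae ?_
    filter_upwards [ae_all_iff.mpr hYZ] with ω hω
    simp [hω, sq]
  simp only [hsq] at key
  rwa [hsum] at key

/-- **Decoupling for functions of the coordinates of a Gaussian vector.**
If `Y` is a centered Gaussian vector with standardized coordinates and correlation matrix `C`,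
and `cm`, `cp` are the smallest and largest eigenvalues of `C`, then for all measurable,
centered, square-integrable `φ i (Y i)` one has
`cm * ∑ ‖φ i (Y i)‖₂² ≤ ‖∑ φ i (Y i)‖₂² ≤ cp * ∑ ‖φ i (Y i)‖₂²`. -/
theorem decoupling_gaussian_vector
    {Ω : Type*} [MeasurableSpace Ω] (μ : Measure Ω) [IsProbabilityMeasure μ]
    {d : ℕ} (Y : Ω → Fin d → ℝ)
    (hGauss : IsCenteredGaussianVec μ Y)
    (hmean : ∀ i, ∫ ω, Y ω i ∂μ = 0)
    (hvar : ∀ i, ∫ ω, (Y ω i) ^ 2 ∂μ = 1)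
    (C : Matrix (Fin d) (Fin d) ℝ)
    (hC : ∀ i j, C i j = ∫ ω, Y ω i * Y ω j ∂μ)
    (cm cp : ℝ)
    (hcmEig : ∃ v : Fin d → ℝ, v ≠ 0 ∧ C.mulVec v = cm • v)
    (hcpEig : ∃ v : Fin d → ℝ, v ≠ 0 ∧ C.mulVec v = cp • v)
    (hcmMin : ∀ (lam : ℝ) (v : Fin d → ℝ), v ≠ 0 → C.mulVec v = lam • v → cm ≤ lam)
    (hcpMax : ∀ (lam : ℝ) (v : Fin d → ℝ), v ≠ 0 → C.mulVec v = lam • v → lam ≤ cp)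
    (φ : Fin d → ℝ → ℝ)
    (hmeas : ∀ i, Measurable (φ i))
    (hcent : ∀ i, ∫ ω, φ i (Y ω i) ∂μ = 0)
    (hL2 : ∀ i, Integrable (fun ω => (φ i (Y ω i)) ^ 2) μ) :
    cm * ∑ i, ∫ ω, (φ i (Y ω i)) ^ 2 ∂μ ≤ ∫ ω, (∑ i, φ i (Y ω i)) ^ 2 ∂μ ∧
      ∫ ω, (∑ i, φ i (Y ω i)) ^ 2 ∂μ ≤ cp * ∑ i, ∫ ω, (φ i (Y ω i)) ^ 2 ∂μ := by
  have hL : ∀ i, MemLp (fun ω => Y ω i) 2 μ := fun i => by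
    simpa [Pi.single_apply] using hGauss.memLp (Pi.single i 1)
  have hsymm : C.IsHermitian := Matrix.IsHermitian.ext fun i j => by simp [hC, mul_comm]
  have hlower : ((1 : ℝ) • C + (-cm) • (1 : Matrix (Fin d) (Fin d) ℝ)).PosSemidef := by
    refine posSemidef_of_forall_eigenvalue_nonneg ?_ fun lam v hv h => ?_
    · simpa [Matrix.IsHermitian] using hsymm
    · have h' := hcmMin (lam + cm) v hv (by
        simp only [Matrix.add_mulVec, Matrix.smul_mulVec, Matrix.one_mulVec, one_smul] at h
        rw [add_smul, ← h]
        module)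
      linarith
  have hupper : ((-1 : ℝ) • C + cp • (1 : Matrix (Fin d) (Fin d) ℝ)).PosSemidef := by
    refine posSemidef_of_forall_eigenvalue_nonneg ?_ fun lam v hv h => ?_
    · simpa [Matrix.IsHermitian] using hsymm
    · have h' := hcpMax (cp - lam) v hv (by
        simp only [Matrix.add_mulVec, Matrix.smul_mulVec, Matrix.one_mulVec] at h
        rw [sub_smul, ← h]
        module)
      linarith
  have h1 := hGauss.quadratic_nonneg hvar hL hC hlower hmeas hcent hL2
  have h2 := hGauss.quadratic_nonneg hvar hL hC hupper hmeas hcent hL2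
  constructor <;> linarith
end

section
/- Let (Ȳ_1, Ȳ_2) be a jointly Gaussian pair of random vectors, Ȳ_1 = (Y_{1,i})_{i=1,…,d_1} and Ȳ_2 = (Y_{2,j})_{j=1,…,d_2}, such that each Ȳ_α is a standard Gaussian vector (E[Y_{α,i}] = 0, E[Y_{α,i} Y_{α,j}] = δ_{ij}), and E[Y_{1,i} Y_{2,j}] = ρ_{i,j}. Let s* be the largest singular value of the matrix R = (ρ_{i,j})_{i=1,…,d_1, j=1,…,d_2}, and set c_± = 1 ± s*. Then for all measurable functions φ_α : R^{d_α} → R with E[φ_α(Ȳ_α)] = 0 and φ_α(Ȳ_α) square-integrable (α = 1, 2), one has c_- (‖φ_1(Ȳ_1)‖_2^2 + ‖φ_2(Ȳ_2)‖_2^2) ≤ ‖φ_1(Ȳ_1) + φ_2(Ȳ_2)‖_2^2 ≤ c_+ (‖φ_1(Ȳ_1)‖_2^2 + ‖φ_2(Ȳ_2)‖_2^2). -/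
open MeasureTheory ProbabilityTheory
open scoped NNReal

/-- `(Y₁, Y₂)` is a jointly centered Gaussian pair of random vectors: every linear combination
of all their coordinates has a centered Gaussian law. -/
def IsJointGaussianPair {Ω : Type*} [MeasurableSpace Ω] (μ : Measure Ω) {d₁ d₂ : ℕ}
    (Y₁ : Ω → Fin d₁ → ℝ) (Y₂ : Ω → Fin d₂ → ℝ) : Prop :=
  ∀ (c₁ : Fin d₁ → ℝ) (c₂ : Fin d₂ → ℝ), ∃ v : ℝ≥0,
    Measure.map (fun ω => ∑ i, c₁ i * Y₁ ω i + ∑ j, c₂ j * Y₂ ω j) μ = gaussianReal 0 v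

open scoped Matrix RealInnerProductSpace

/-- A bilinear form evaluated on a finite linear combination. -/
lemma LinearMap.apply_finsuppSum_self {ι V : Type*} [AddCommGroup V] [Module ℝ V]
    (B : V →ₗ[ℝ] V →ₗ[ℝ] ℝ) (v : ι → V) (c : ι →₀ ℝ) :
    (c.sum fun i a => c.sum fun j b => a * B (v i) (v j) * b) =
      B (Finsupp.linearCombination ℝ v c) (Finsupp.linearCombination ℝ v c) := by
  simp only [Finsupp.linearCombination_apply, Finsupp.sum, map_sum, map_smul, LinearMap.sum_apply,
    LinearMap.smul_apply, smul_eq_mul, Finset.mul_sum]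
  rw [Finset.sum_comm]
  exact Finset.sum_congr rfl fun i _ => Finset.sum_congr rfl fun j _ => by ring

lemma Matrix.PosSemidef.of_bilin {ι V : Type*} [AddCommGroup V] [Module ℝ V]
    (B : V →ₗ[ℝ] V →ₗ[ℝ] ℝ) (hsymm : ∀ x y, B x y = B y x) (hnonneg : ∀ x, 0 ≤ B x x)
    (v : ι → V) : (Matrix.of fun i j => B (v i) (v j)).PosSemidef := by
  refine ⟨by ext i j; simp [hsymm (v i)], fun c => ?_⟩
  have := B.apply_finsuppSum_self v c
  simp only [star_trivial, Matrix.of_apply]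
  rw [this]
  exact hnonneg _

/-- Entrywise powers of a positive semidefinite matrix are positive semidefinite. -/
lemma Matrix.PosSemidef.map_pow {ι : Type*} {A : Matrix ι ι ℝ} (hA : A.PosSemidef) {n : ℕ}
    (hn : n ≠ 0) : (A.map (· ^ n)).PosSemidef := by
  induction n, Nat.one_le_iff_ne_zero.mpr hn using Nat.le_induction with
  | base => simpa using hA
  | succ n hn ih =>
    have h := PosSemidef.hadamard (𝕜 := ℝ) (ih (by lia)) hA
    have heq : A.map (· ^ (n + 1)) = A.map (· ^ n) ⊙ A := by
      ext i j
      simp [pow_succ]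
    rw [heq]
    exact h

/-- An entrywise convergent sum of positive semidefinite matrices is positive semidefinite. -/
lemma Matrix.PosSemidef.of_hasSum {ι : Type*} {A : ℕ → Matrix ι ι ℝ} {N : Matrix ι ι ℝ}
    (hA : ∀ n, (A n).PosSemidef) (hN : ∀ i j, HasSum (fun n => A n i j) (N i j)) :
    N.PosSemidef := by
  refine ⟨?_, fun c => ?_⟩
  · ext i j
    simp only [Matrix.conjTranspose_apply, star_trivial]
    refine (hN j i).unique ?_
    convert hN i j using 2 with n
    exact ((hA n).1.apply j i).symm
  · have : HasSum (fun n => c.sum fun i a => c.sum fun j b => star a * A n i j * b)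
        (c.sum fun i a => c.sum fun j b => star a * N i j * b) :=
      hasSum_sum fun i _ => hasSum_sum fun j _ => ((hN i j).mul_left _).mul_right _
    exact this.nonneg fun n => (hA n).2 c

/-- If all eigenvalues of `Rᵀ R` are at most `s²` then `|Rv|² ≤ s² |v|²`. -/
lemma Matrix.dotProduct_mulVec_self_le {m n : Type*} [Fintype m] [Fintype n] (R : Matrix m n ℝ)
    (s : ℝ) (hs : ∀ (t : ℝ) (v : n → ℝ), v ≠ 0 → (Rᵀ * R).mulVec v = t • v → t ≤ s ^ 2)
    (v : n → ℝ) : R.mulVec v ⬝ᵥ R.mulVec v ≤ s ^ 2 * (v ⬝ᵥ v) := by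
  classical
  have hH : (s ^ 2 • (1 : Matrix n n ℝ) - Rᵀ * R).IsHermitian := by
    ext i j
    simp [Matrix.one_apply, eq_comm, Matrix.mul_apply, mul_comm]
  have hP : (s ^ 2 • (1 : Matrix n n ℝ) - Rᵀ * R).PosSemidef := by
    rw [hH.posSemidef_iff_eigenvalues_nonneg]
    intro i
    have h := hH.mulVec_eigenvectorBasis i
    have hv : (hH.eigenvectorBasis i : n → ℝ) ≠ 0 := by
      have := hH.eigenvectorBasis.orthonormal.ne_zero i
      intro h0
      exact this (by ext j; exact congrFun h0 j)
    have := hs (s ^ 2 - hH.eigenvalues i) _ hv (by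
      rw [Matrix.sub_mulVec, Matrix.smul_mulVec, Matrix.one_mulVec] at h
      rw [sub_smul, ← h]; abel)
    simpa using this
  have := hP.dotProduct_mulVec_nonneg v
  rw [Matrix.sub_mulVec, Matrix.smul_mulVec, Matrix.one_mulVec, dotProduct_sub,
    dotProduct_smul, ← Matrix.mulVec_mulVec, star_trivial, Matrix.dotProduct_mulVec,
    Matrix.vecMul_transpose] at this
  simpa using this

lemma Matrix.abs_dotProduct_mulVec_le {m n : Type*} [Fintype m] [Fintype n] (R : Matrix m n ℝ)
    {s : ℝ} (hs0 : 0 ≤ s)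
    (hs : ∀ (t : ℝ) (v : n → ℝ), v ≠ 0 → (Rᵀ * R).mulVec v = t • v → t ≤ s ^ 2)
    (u : m → ℝ) (v : n → ℝ) : 2 * |u ⬝ᵥ R.mulVec v| ≤ s * (u ⬝ᵥ u + v ⬝ᵥ v) := by
  have h1 := R.dotProduct_mulVec_self_le s hs v
  have h2 : (u ⬝ᵥ R.mulVec v) ^ 2 ≤ (u ⬝ᵥ u) * (R.mulVec v ⬝ᵥ R.mulVec v) := by
    simpa [dotProduct, sq] using Finset.sum_mul_sq_le_sq_mul_sq Finset.univ u (R.mulVec v)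
  have hu : 0 ≤ u ⬝ᵥ u := by simpa using dotProduct_star_self_nonneg u
  have hv : 0 ≤ v ⬝ᵥ v := by simpa using dotProduct_star_self_nonneg v
  refine abs_le_of_sq_le_sq' ?_ (by positivity) |>.2
  rw [mul_pow, sq_abs]
  nlinarith [mul_le_mul_of_nonneg_left h1 hu,
    mul_nonneg (sq_nonneg s) (sq_nonneg (u ⬝ᵥ u - v ⬝ᵥ v))]

/-- The kernel with blocks `s (exp ⟨t, t'⟩ - 1)` on the diagonal and `exp ⟨t, R u⟩ - 1` off the
diagonal is positive semidefinite when `s ∈ [0, 1]` bounds the singular values of `R`. -/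
lemma Matrix.posSemidef_exp_kernel {m n : Type*} [Fintype m] [Fintype n] (R : Matrix m n ℝ)
    {s : ℝ} (hs0 : 0 ≤ s) (hs1 : s ≤ 1)
    (hs : ∀ (t : ℝ) (v : n → ℝ), v ≠ 0 → (Rᵀ * R).mulVec v = t • v → t ≤ s ^ 2) :
    (Matrix.fromBlocks
      (Matrix.of fun t t' : m → ℝ => s * (Real.exp (t ⬝ᵥ t') - 1))
      (Matrix.of fun (t : m → ℝ) (u : n → ℝ) => Real.exp (t ⬝ᵥ R.mulVec u) - 1)
      (Matrix.of fun (u : n → ℝ) (t : m → ℝ) => Real.exp (t ⬝ᵥ R.mulVec u) - 1)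
      (Matrix.of fun u u' : n → ℝ => s * (Real.exp (u ⬝ᵥ u') - 1))).PosSemidef := by
  classical
  let P : (m → ℝ) ⊕ (n → ℝ) → (m ⊕ n → ℝ) :=
    Sum.elim (fun t => Sum.elim t 0) (fun u => Sum.elim 0 u)
  let G : Matrix (m ⊕ n) (m ⊕ n) ℝ := fromBlocks (s • 1) R Rᵀ (s • 1)
  let D : Matrix ((m → ℝ) ⊕ (n → ℝ)) ((m → ℝ) ⊕ (n → ℝ)) ℝ :=
    fromBlocks (of fun t t' => t ⬝ᵥ t') 0 0 (of fun u u' => u ⬝ᵥ u')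
  let M : Matrix ((m → ℝ) ⊕ (n → ℝ)) ((m → ℝ) ⊕ (n → ℝ)) ℝ :=
    fromBlocks (of fun t t' => s * (t ⬝ᵥ t')) (of fun t u => t ⬝ᵥ R.mulVec u)
      (of fun u t => t ⬝ᵥ R.mulVec u) (of fun u u' => s * (u ⬝ᵥ u'))
  have hcross (u : n → ℝ) (t : m → ℝ) : u ⬝ᵥ Rᵀ.mulVec t = t ⬝ᵥ R.mulVec u := by
    rw [Matrix.dotProduct_mulVec, Matrix.vecMul_transpose, dotProduct_comm]
  have hD : D.PosSemidef := by
    have := PosSemidef.of_bilin (Matrix.toLinearMap₂' ℝ (1 : Matrix (m ⊕ n) (m ⊕ n) ℝ))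
      (fun x y => by simp [Matrix.toLinearMap₂'_apply', dotProduct_comm])
      (fun x => by simpa [Matrix.toLinearMap₂'_apply'] using dotProduct_star_self_nonneg x) P
    convert this using 1
    ext (t | u) (t' | u') <;> simp [D, P, Matrix.toLinearMap₂'_apply']
  have hM : M.PosSemidef := by
    have := PosSemidef.of_bilin (Matrix.toLinearMap₂' ℝ G)
      (fun x y => by
        rw [Matrix.toLinearMap₂'_apply', Matrix.toLinearMap₂'_apply', Matrix.dotProduct_mulVec,
          ← Matrix.mulVec_transpose, dotProduct_comm]
        simp [G, fromBlocks_transpose])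
      (fun x => by
        rw [Matrix.toLinearMap₂'_apply']
        obtain ⟨t, u, rfl⟩ : ∃ t u, x = Sum.elim t u := ⟨x ∘ Sum.inl, x ∘ Sum.inr, by simp⟩
        have := R.abs_dotProduct_mulVec_le hs0 hs t u
        have h2 := neg_abs_le (t ⬝ᵥ R.mulVec u)
        simp only [G, fromBlocks_mulVec, Sum.elim_comp_inl, Sum.elim_comp_inr,
          sumElim_dotProduct_sumElim, dotProduct_add, hcross, Matrix.smul_mulVec,
          Matrix.one_mulVec, dotProduct_smul, smul_eq_mul]
        linarith) P
    convert this using 1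
    ext (t | u) (t' | u') <;>
      simp [M, P, G, Matrix.toLinearMap₂'_apply', fromBlocks_mulVec, Matrix.smul_mulVec, hcross]
  have hexp (x : ℝ) : HasSum (fun k : ℕ => x ^ (k + 1) / (k + 1).factorial) (Real.exp x - 1) := by
    have := NormedSpace.expSeries_div_hasSum_exp (𝔸 := ℝ) x
    rw [← Real.exp_eq_exp_ℝ] at this
    simpa using (hasSum_nat_add_iff' 1).mpr this
  refine PosSemidef.of_hasSum (A := fun k => ((k + 1).factorial : ℝ)⁻¹ •
    (M.map (· ^ (k + 1)) + (s - s ^ (k + 1)) • D.map (· ^ (k + 1)))) (fun k => ?_) ?_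
  · refine ((hM.map_pow (by simp)).add ((hD.map_pow (by simp)).smul ?_)).smul (by positivity)
    simpa using pow_le_of_le_one hs0 hs1 (by simp)
  · rintro (t | u) (t' | u')
    · convert! ((hexp (t ⬝ᵥ t')).mul_left s) using 2 with k
      simp [M, D]; ring
    · convert! (hexp (t ⬝ᵥ R.mulVec u')) using 2 with k
      simp [M, D]; ring
    · convert! (hexp (t' ⬝ᵥ R.mulVec u)) using 2 with k
      simp [M, D]; ring
    · convert! ((hexp (u ⬝ᵥ u')).mul_left s) using 2 with k
      simp [M, D]; ring

lemma MeasureTheory.Measure.ext_of_forall_integral_exp_dual {E : Type*} [NormedAddCommGroup E]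
    [NormedSpace ℝ E] [CompleteSpace E] [SecondCountableTopology E] [MeasurableSpace E]
    [BorelSpace E] {μ ν : Measure E} [IsFiniteMeasure μ] [IsFiniteMeasure ν]
    (hμ : ∀ L : StrongDual ℝ E, Integrable (fun x => Real.exp (L x)) μ)
    (h : ∀ L : StrongDual ℝ E, ∫ x, Real.exp (L x) ∂μ = ∫ x, Real.exp (L x) ∂ν) : μ = ν := by
  refine Measure.ext_of_charFunDual (funext fun L => ?_)
  have hmgf : mgf L μ = mgf L ν := by
    ext t
    simpa [mgf] using h (t • L)
  have h0 : μ = 0 ↔ ν = 0 := by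
    have := h 0
    simp only [zero_apply, Real.exp_zero, integral_const, smul_eq_mul,
      mul_one] at this
    rw [← Measure.measure_univ_eq_zero, ← measureReal_eq_zero_iff, this, measureReal_eq_zero_iff,
      Measure.measure_univ_eq_zero]
  have hset : integrableExpSet L μ = Set.univ :=
    Set.eq_univ_of_forall fun t => by simpa [integrableExpSet] using hμ (t • L)
  have hc := eqOn_complexMGF_of_mgf' hmgf h0
  rw [charFunDual_eq_charFun_map_one, charFunDual_eq_charFun_map_one,
    Measure.ext_of_complexMGF_eq (by fun_prop) (by fun_prop)
      (funext fun z => hc (by simp [hset]))]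

/-- An integrable function orthogonal to all real exponentials vanishes almost everywhere. -/
lemma MeasureTheory.ae_eq_zero_of_forall_integral_mul_exp_dual {E : Type*} [NormedAddCommGroup E]
    [NormedSpace ℝ E] [CompleteSpace E] [SecondCountableTopology E] [MeasurableSpace E]
    [BorelSpace E] {ν : Measure E} {f : E → ℝ}
    (hf : Integrable f ν)
    (hint : ∀ L : StrongDual ℝ E, Integrable (fun x => f x * Real.exp (L x)) ν)
    (h : ∀ L : StrongDual ℝ E, ∫ x, f x * Real.exp (L x) ∂ν = 0) : f =ᵐ[ν] 0 := by
  have key (g : E → ℝ) (hg : Integrable g ν) (L : StrongDual ℝ E) :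
      ∫ x, Real.exp (L x) ∂(ν.withDensity fun x => ENNReal.ofReal (g x)) =
        ∫ x, max (g x * Real.exp (L x)) 0 ∂ν := by
    rw [integral_withDensity_eq_integral_toReal_smul₀ hg.aemeasurable.ennreal_ofReal (by simp)]
    refine integral_congr_ae (.of_forall fun x => ?_)
    simp only [ENNReal.toReal_ofReal', smul_eq_mul]
    rw [max_mul_of_nonneg _ _ (Real.exp_nonneg _), zero_mul]
  have hfin (g : E → ℝ) (hg : Integrable g ν) :
      IsFiniteMeasure (ν.withDensity fun x => ENNReal.ofReal (g x)) :=
    isFiniteMeasure_withDensity_ofReal hg.2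
  have := hfin f hf
  have := hfin _ hf.neg
  have heq : (ν.withDensity fun x => ENNReal.ofReal (f x)) =
      ν.withDensity fun x => ENNReal.ofReal ((-f) x) := by
    refine Measure.ext_of_forall_integral_exp_dual (fun L => ?_) fun L => ?_
    · rw [integrable_withDensity_iff_integrable_smul₀' hf.aemeasurable.ennreal_ofReal (by simp)]
      convert (hint L).pos_part using 2 with x
      simp only [ENNReal.toReal_ofReal', smul_eq_mul]
      rw [max_mul_of_nonneg _ _ (Real.exp_nonneg _), zero_mul]
    · rw [key _ hf, key _ hf.neg, ← sub_eq_zero, ← integral_sub (hint L).pos_part]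
      · refine (integral_congr_ae (.of_forall fun x => ?_)).trans (h L)
        simpa only [Pi.neg_apply, neg_mul] using max_zero_sub_eq_self (f x * Real.exp (L x))
      · simpa using (hint L).neg.pos_part
  rw [withDensity_eq_iff hf.aemeasurable.ennreal_ofReal hf.neg.aemeasurable.ennreal_ofReal
    (by simpa using hf.lintegral_lt_top.ne)] at heq
  filter_upwards [heq] with x hx
  rw [← ENNReal.toReal_eq_toReal_iff' (by simp) (by simp)] at hx
  simp only [ENNReal.toReal_ofReal', Pi.neg_apply] at hx
  rw [Pi.zero_apply, ← max_zero_sub_eq_self (f x), hx, sub_self]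

lemma MeasureTheory.Lp.topologicalClosure_span_exp_eq_top {n : Type*} [Fintype n]
    {ν : Measure (n → ℝ)} [IsFiniteMeasure ν] {e : (n → ℝ) → Lp ℝ 2 ν} (a : (n → ℝ) → ℝ)
    (he : ∀ t, e t =ᵐ[ν] fun x => Real.exp (t ⬝ᵥ x - a t)) :
    (Submodule.span ℝ (Set.range e)).topologicalClosure = ⊤ := by
  classical
  rw [Submodule.topologicalClosure_eq_top_iff, Submodule.eq_bot_iff]
  intro f hf
  have hdual (L : StrongDual ℝ (n → ℝ)) : ∃ t, ∀ x, Real.exp (L x) =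
      Real.exp (a t) * Real.exp (t ⬝ᵥ x - a t) := by
    refine ⟨fun i => L (Pi.single i 1), fun x => ?_⟩
    rw [← Real.exp_add]
    congr 1
    rw [add_sub_cancel]
    conv_lhs => rw [pi_eq_sum_univ' x]
    simp [dotProduct, mul_comm]
  have hprod (t) : (fun x => f x * (e t) x) =ᵐ[ν] fun x => f x * Real.exp (t ⬝ᵥ x - a t) := by
    filter_upwards [he t] with x hx
    rw [hx]
  rw [Lp.eq_zero_iff_ae_eq_zero]
  refine ae_eq_zero_of_forall_integral_mul_exp_dual ((Lp.memLp f).integrable (by norm_num))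
    (fun L => ?_) fun L => ?_
  · obtain ⟨t, ht⟩ := hdual L
    simp_rw [ht, mul_left_comm]
    exact (((Lp.memLp f).integrable_mul (Lp.memLp (e t))).congr (hprod t)).const_mul _
  · obtain ⟨t, ht⟩ := hdual L
    simp_rw [ht, mul_left_comm]
    rw [integral_const_mul, ← integral_congr_ae (hprod t)]
    have := (Submodule.mem_orthogonal' _ _).mp hf (e t) (Submodule.subset_span ⟨t, rfl⟩)
    rw [L2.inner_def] at this
    simp only [RCLike.inner_apply, conj_trivial] at this
    simp_rw [mul_comm (f _)]
    rw [this, mul_zero]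

lemma MeasureTheory.integral_sum_mul_sq {Ω κ : Type*} [MeasurableSpace Ω] {μ : Measure Ω}
    [Fintype κ] {Z : κ → Ω → ℝ} (hZ : ∀ k, MemLp (Z k) 2 μ) (c : κ → ℝ) :
    ∫ ω, (∑ k, c k * Z k ω) ^ 2 ∂μ = ∑ k, ∑ l, c k * c l * ∫ ω, Z k ω * Z l ω ∂μ := by
  have h (k l) : Integrable (fun ω => c k * c l * (Z k ω * Z l ω)) μ :=
    ((hZ k).integrable_mul (hZ l)).const_mul _
  simp_rw [sq, Finset.sum_mul_sum, mul_mul_mul_comm (c _) (Z _ _)]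
  rw [integral_finsetSum _ fun k _ => integrable_finsetSum _ fun l _ => h k l]
  refine Finset.sum_congr rfl fun k _ => ?_
  rw [integral_finsetSum _ fun l _ => h k l]
  exact Finset.sum_congr rfl fun l _ => integral_const_mul _ _

/-- The exponential moments of a centered Gaussian variable. -/
lemma ProbabilityTheory.integral_exp_of_map_eq_gaussianReal {Ω : Type*} [MeasurableSpace Ω]
    {μ : Measure Ω} [IsProbabilityMeasure μ] {X : Ω → ℝ} {v : ℝ≥0}
    (h : μ.map X = gaussianReal 0 v) :
    Integrable (fun ω => Real.exp (X ω)) μ ∧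
      ∫ ω, Real.exp (X ω) ∂μ = Real.exp ((∫ ω, X ω ^ 2 ∂μ) / 2) := by
  have hX : AEMeasurable X μ := AEMeasurable.of_map_ne_zero (by simp [h, NeZero.ne])
  have hsq : ∫ ω, X ω ^ 2 ∂μ = v := by
    rw [← integral_map (φ := X) (f := fun x => x ^ 2) hX (by fun_prop), h]
    have := variance_fun_id_gaussianReal (μ := 0) (v := v)
    rwa [variance_of_integral_eq_zero (by fun_prop) (by simp)] at this
  constructor
  · have := integrable_exp_mul_gaussianReal (μ := 0) (v := v) 1
    rw [← h] at this
    simpa [Function.comp_def] using this.comp_aemeasurable hX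
  · have := mgf_gaussianReal h 1
    simpa [mgf, hsq] using this

namespace IsJointGaussianPair

variable {Ω : Type*} [MeasurableSpace Ω] {μ : Measure Ω} {d₁ d₂ : ℕ}
  {Y₁ : Ω → Fin d₁ → ℝ} {Y₂ : Ω → Fin d₂ → ℝ}

lemma memLp_left (h : IsJointGaussianPair μ Y₁ Y₂) (i : Fin d₁) :
    MemLp (fun ω => Y₁ ω i) 2 μ := by
  obtain ⟨v, hv⟩ := h (Pi.single i 1) 0
  simp only [Pi.single_apply, ite_mul, one_mul, zero_mul, Finset.sum_ite_eq', Finset.mem_univ,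
    if_true, Pi.zero_apply, Finset.sum_const_zero, add_zero] at hv
  have hX : AEMeasurable (fun ω => Y₁ ω i) μ :=
    AEMeasurable.of_map_ne_zero (by simp [hv, NeZero.ne])
  have := memLp_id_gaussianReal' (μ := 0) (v := v) 2 (by simp)
  rw [← hv] at this
  exact this.comp_of_map hX

lemma symm (h : IsJointGaussianPair μ Y₁ Y₂) : IsJointGaussianPair μ Y₂ Y₁ := fun c₂ c₁ => by
  simpa only [add_comm] using h c₁ c₂

lemma memLp_right (h : IsJointGaussianPair μ Y₁ Y₂) (j : Fin d₂) :
    MemLp (fun ω => Y₂ ω j) 2 μ :=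
  h.symm.memLp_left j

lemma integral_exp [IsProbabilityMeasure μ] (h : IsJointGaussianPair μ Y₁ Y₂)
    (hcov₁ : ∀ i j, ∫ ω, Y₁ ω i * Y₁ ω j ∂μ = if i = j then 1 else 0)
    (hcov₂ : ∀ i j, ∫ ω, Y₂ ω i * Y₂ ω j ∂μ = if i = j then 1 else 0)
    {R : Matrix (Fin d₁) (Fin d₂) ℝ} (hR : ∀ i j, R i j = ∫ ω, Y₁ ω i * Y₂ ω j ∂μ)
    (a : Fin d₁ → ℝ) (b : Fin d₂ → ℝ) :
    Integrable (fun ω => Real.exp (a ⬝ᵥ Y₁ ω + b ⬝ᵥ Y₂ ω)) μ ∧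
      ∫ ω, Real.exp (a ⬝ᵥ Y₁ ω + b ⬝ᵥ Y₂ ω) ∂μ =
        Real.exp ((a ⬝ᵥ a + b ⬝ᵥ b) / 2 + a ⬝ᵥ R.mulVec b) := by
  obtain ⟨v, hv⟩ := h a b
  have key : ∫ ω, (a ⬝ᵥ Y₁ ω + b ⬝ᵥ Y₂ ω) ^ 2 ∂μ =
      a ⬝ᵥ a + b ⬝ᵥ b + 2 * (a ⬝ᵥ R.mulVec b) := by
    have h1 := integral_sum_mul_sq (μ := μ)
      (Z := Sum.elim (fun i ω => Y₁ ω i) (fun j ω => Y₂ ω j))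
      (by rintro (i | j); exacts [h.memLp_left i, h.memLp_right j]) (Sum.elim a b)
    have hR' (i j) : ∫ ω, Y₂ ω j * Y₁ ω i ∂μ = R i j := by simp_rw [hR, mul_comm]
    simp only [Fintype.sum_sum_type, Sum.elim_inl, Sum.elim_inr, hcov₁, hcov₂, hR', ← hR,
      mul_ite, mul_one, mul_zero, Finset.sum_ite_eq, Finset.mem_univ, if_true,
      Finset.sum_add_distrib] at h1
    have hab : ∑ i, ∑ j, a i * b j * R i j = a ⬝ᵥ R.mulVec b := by
      simp only [dotProduct, Matrix.mulVec, Finset.mul_sum]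
      exact Finset.sum_congr rfl fun i _ => Finset.sum_congr rfl fun j _ => by ring
    have hba : ∑ j, ∑ i, b j * a i * R i j = a ⬝ᵥ R.mulVec b := by
      rw [Finset.sum_comm, ← hab]
      simp only [mul_comm (b _)]
    rw [hab, hba] at h1
    simp only [dotProduct] at h1 ⊢
    rw [h1]
    ring
  obtain ⟨h1, h2⟩ := integral_exp_of_map_eq_gaussianReal hv
  refine ⟨h1, h2.trans ?_⟩
  congr 1
  simp only [dotProduct] at key ⊢
  rw [key]
  ring

end IsJointGaussianPair

lemma ContinuousLinearMap.map_mem_topologicalClosure_span {E F ι κ : Type*} [AddCommGroup E]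
    [Module ℝ E] [TopologicalSpace E] [IsTopologicalAddGroup E] [ContinuousSMul ℝ E]
    [AddCommGroup F] [Module ℝ F] [TopologicalSpace F] [IsTopologicalAddGroup F]
    [ContinuousSMul ℝ F] (A : E →L[ℝ] F) {e : ι → E} {v : κ → F}
    (hA : ∀ i, A (e i) ∈ Set.range v) {x : E}
    (hx : x ∈ (Submodule.span ℝ (Set.range e)).topologicalClosure) :
    A x ∈ (Submodule.span ℝ (Set.range v)).topologicalClosure := by
  refine Submodule.topologicalClosure_minimal (t := (Submodule.span ℝ
    (Set.range v)).topologicalClosure.comap A.toLinearMap) _ ?_ ?_ hx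
  · rw [Submodule.span_le]
    rintro _ ⟨k, rfl⟩
    exact Submodule.le_topologicalClosure _ (Submodule.subset_span (hA k))
  · exact (Submodule.isClosed_topologicalClosure _).preimage A.continuous

/-- Every square-integrable function of a random vector is an `L²`-limit of linear combinations
of exponentials. -/
lemma MeasureTheory.MemLp.toLp_comp_mem_topologicalClosure_span_exp {Ω n : Type*}
    [MeasurableSpace Ω] {μ : Measure Ω} [IsFiniteMeasure μ] [Fintype n] {Y : Ω → n → ℝ}
    (hY : AEMeasurable Y μ) {φ : (n → ℝ) → ℝ} (hφ : Measurable φ)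
    (hL : MemLp (fun ω => φ (Y ω)) 2 μ) {a : (n → ℝ) → ℝ}
    (he : ∀ t, MemLp (fun ω => Real.exp (t ⬝ᵥ Y ω - a t)) 2 μ) :
    hL.toLp ∈ (Submodule.span ℝ (Set.range fun t => (he t).toLp)).topologicalClosure := by
  have hmp : MeasurePreserving (hY.mk Y) μ (μ.map Y) :=
    ⟨hY.measurable_mk, Measure.map_congr hY.ae_eq_mk.symm⟩
  have hmap {g : (n → ℝ) → ℝ} (hg : Measurable g) (h : MemLp (fun ω => g (Y ω)) 2 μ) :
      MemLp g 2 (μ.map Y) :=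
    (memLp_map_measure_iff hg.aestronglyMeasurable hY).mpr h
  let J := (Lp.compMeasurePreservingₗᵢ ℝ (E := ℝ) (p := 2) (hY.mk Y) hmp).toContinuousLinearMap
  have hJ {g : (n → ℝ) → ℝ} (hg : Measurable g) (h : MemLp (fun ω => g (Y ω)) 2 μ) :
      J (hmap hg h).toLp = h.toLp := by
    have : J (hmap hg h).toLp = _ := Lp.toLp_compMeasurePreserving (hmap hg h) hmp
    rw [this, MemLp.toLp_eq_toLp_iff]
    filter_upwards [hY.ae_eq_mk] with ω hω
    simp [hω]
  have hmeas (t : n → ℝ) : Measurable fun x : n → ℝ => Real.exp (t ⬝ᵥ x - a t) := by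
    simp only [dotProduct]
    fun_prop
  have htop := Lp.topologicalClosure_span_exp_eq_top (ν := μ.map Y)
    (e := fun t => (hmap (hmeas t) (he t)).toLp) a (fun t => MemLp.coeFn_toLp _)
  rw [← hJ hφ hL]
  exact J.map_mem_topologicalClosure_span (fun t => ⟨t, (hJ (hmeas t) (he t)).symm⟩)
    (htop ▸ Submodule.mem_top)

lemma LinearMap.apply_self_nonneg_of_posSemidef {ι V : Type*} [AddCommGroup V] [Module ℝ V]
    [TopologicalSpace V] [IsTopologicalAddGroup V] [ContinuousSMul ℝ V]
    (B : V →ₗ[ℝ] V →ₗ[ℝ] ℝ) (hB : Continuous fun x => B x x) {v : ι → V}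
    (hv : (Matrix.of fun i j => B (v i) (v j)).PosSemidef) {x : V}
    (hx : x ∈ (Submodule.span ℝ (Set.range v)).topologicalClosure) : 0 ≤ B x x := by
  refine closure_minimal (s := (Submodule.span ℝ (Set.range v) : Set V)) (t := {x | 0 ≤ B x x})
    (fun y hy => ?_) (isClosed_le continuous_const hB) hx
  obtain ⟨c, rfl⟩ := (Finsupp.mem_span_range_iff_exists_finsupp).mp hy
  have := hv.2 c
  simp only [star_trivial, Matrix.of_apply, B.apply_finsuppSum_self] at this
  rwa [Finsupp.linearCombination_apply] at this

/-- If the vectors `e₁ t` and `e₂ u` have the covariances prescribed by a positive semidefinite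
block kernel, the corresponding quadratic inequality holds on the closed spans. -/
lemma inner_nonneg_of_posSemidef_fromBlocks {H ι₁ ι₂ : Type*} [NormedAddCommGroup H]
    [InnerProductSpace ℝ H] (o : H) (ho : ⟪o, o⟫ = 1) (s : ℝ) {e₁ : ι₁ → H} {e₂ : ι₂ → H}
    (hK : (Matrix.fromBlocks
      (Matrix.of fun t t' => s * (⟪e₁ t, e₁ t'⟫ - ⟪o, e₁ t⟫ * ⟪o, e₁ t'⟫))
      (Matrix.of fun t u => ⟪e₁ t, e₂ u⟫ - ⟪o, e₁ t⟫ * ⟪o, e₂ u⟫)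
      (Matrix.of fun u t => ⟪e₁ t, e₂ u⟫ - ⟪o, e₁ t⟫ * ⟪o, e₂ u⟫)
      (Matrix.of fun u u' => s * (⟪e₂ u, e₂ u'⟫ - ⟪o, e₂ u⟫ * ⟪o, e₂ u'⟫))).PosSemidef)
    {f g : H} (hf : f ∈ (Submodule.span ℝ (Set.range e₁)).topologicalClosure)
    (hg : g ∈ (Submodule.span ℝ (Set.range e₂)).topologicalClosure)
    (hof : ⟪o, f⟫ = 0) (hog : ⟪o, g⟫ = 0) :
    0 ≤ s * (⟪f, f⟫ + ⟪g, g⟫) + 2 * ⟪f, g⟫ := by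
  obtain ⟨C, hC⟩ : ∃ C : H →L[ℝ] H, ∀ x, C x = x - ⟪o, x⟫ • o :=
    ⟨ContinuousLinearMap.id ℝ H - (innerSL ℝ o).smulRight o, fun x => by simp⟩
  have hCC (x y : H) : ⟪C x, C y⟫ = ⟪x, y⟫ - ⟪o, x⟫ * ⟪o, y⟫ := by
    simp only [hC, inner_sub_left, inner_sub_right, inner_smul_left, inner_smul_right, ho,
      real_inner_comm o x, conj_trivial]
    ring
  obtain ⟨B, hB⟩ : ∃ B : (H × H) →ₗ[ℝ] (H × H) →ₗ[ℝ] ℝ, ∀ x y, B x y =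
      s * (⟪x.1, y.1⟫ + ⟪x.2, y.2⟫) + (⟪x.1, y.2⟫ + ⟪x.2, y.1⟫) := by
    refine ⟨s • ((innerₗ H).compl₁₂ (LinearMap.fst ℝ H H) (LinearMap.fst ℝ H H) +
      (innerₗ H).compl₁₂ (LinearMap.snd ℝ H H) (LinearMap.snd ℝ H H)) +
      ((innerₗ H).compl₁₂ (LinearMap.fst ℝ H H) (LinearMap.snd ℝ H H) +
      (innerₗ H).compl₁₂ (LinearMap.snd ℝ H H) (LinearMap.fst ℝ H H)), fun x y => ?_⟩
    simp [mul_add]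
  let v : ι₁ ⊕ ι₂ → H × H := Sum.elim (fun t => (C (e₁ t), 0)) (fun u => (0, C (e₂ u)))
  have hv : (Matrix.of fun i j => B (v i) (v j)).PosSemidef := by
    convert hK using 1
    ext (t | u) (t' | u')
    · simp [hB, v, hCC]
    · simp [hB, v, hCC]
    · simp [hB, v, hCC, real_inner_comm, mul_comm]
    · simp [hB, v, hCC]
  have hf' := ((ContinuousLinearMap.inl ℝ H H).comp C).map_mem_topologicalClosure_span
    (v := v) (fun t => ⟨Sum.inl t, by simp [v]⟩) hf
  have hg' := ((ContinuousLinearMap.inr ℝ H H).comp C).map_mem_topologicalClosure_span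
    (v := v) (fun u => ⟨Sum.inr u, by simp [v]⟩) hg
  have := B.apply_self_nonneg_of_posSemidef (by simp only [hB]; fun_prop) hv (add_mem hf' hg')
  simp only [hB, ContinuousLinearMap.comp_apply, ContinuousLinearMap.inl_apply,
    ContinuousLinearMap.inr_apply, Prod.mk_add_mk, add_zero, zero_add, hC, hof, hog, zero_smul,
    sub_zero, real_inner_comm f g] at this
  linarith

lemma MeasureTheory.MemLp.inner_toLp {Ω : Type*} [MeasurableSpace Ω] {μ : Measure Ω}
    {f g : Ω → ℝ} (hf : MemLp f 2 μ) (hg : MemLp g 2 μ) :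
    ⟪hf.toLp, hg.toLp⟫ = ∫ ω, f ω * g ω ∂μ := by
  rw [L2.inner_def]
  refine integral_congr_ae ?_
  filter_upwards [hf.coeFn_toLp, hg.coeFn_toLp] with ω h1 h2
  simp [h1, h2, mul_comm]

/-- The covariance bound for functions of two jointly Gaussian standard vectors. -/
lemma IsJointGaussianPair.integral_mul_nonneg
    {Ω : Type*} [MeasurableSpace Ω] {μ : Measure Ω} [IsProbabilityMeasure μ]
    {d₁ d₂ : ℕ} {Y₁ : Ω → Fin d₁ → ℝ} {Y₂ : Ω → Fin d₂ → ℝ}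
    (h : IsJointGaussianPair μ Y₁ Y₂)
    (hcov₁ : ∀ i j, ∫ ω, Y₁ ω i * Y₁ ω j ∂μ = if i = j then 1 else 0)
    (hcov₂ : ∀ i j, ∫ ω, Y₂ ω i * Y₂ ω j ∂μ = if i = j then 1 else 0)
    {R : Matrix (Fin d₁) (Fin d₂) ℝ} (hR : ∀ i j, R i j = ∫ ω, Y₁ ω i * Y₂ ω j ∂μ)
    {s : ℝ} (hs0 : 0 ≤ s) (hs1 : s ≤ 1)
    (hs : ∀ (t : ℝ) (v : Fin d₂ → ℝ), v ≠ 0 → (Rᵀ * R).mulVec v = t • v → t ≤ s ^ 2)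
    {φ₁ : (Fin d₁ → ℝ) → ℝ} {φ₂ : (Fin d₂ → ℝ) → ℝ}
    (hφ₁ : Measurable φ₁) (hφ₂ : Measurable φ₂)
    (hcent₁ : ∫ ω, φ₁ (Y₁ ω) ∂μ = 0) (hcent₂ : ∫ ω, φ₂ (Y₂ ω) ∂μ = 0)
    (hL₁ : MemLp (fun ω => φ₁ (Y₁ ω)) 2 μ) (hL₂ : MemLp (fun ω => φ₂ (Y₂ ω)) 2 μ) :
    0 ≤ s * ((∫ ω, (φ₁ (Y₁ ω)) ^ 2 ∂μ) + ∫ ω, (φ₂ (Y₂ ω)) ^ 2 ∂μ) +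
      2 * ∫ ω, φ₁ (Y₁ ω) * φ₂ (Y₂ ω) ∂μ := by
  have hY₁ : AEMeasurable Y₁ μ := aemeasurable_pi_iff.mpr fun i => (h.memLp_left i).aemeasurable
  have hY₂ : AEMeasurable Y₂ μ := aemeasurable_pi_iff.mpr fun i => (h.memLp_right i).aemeasurable
  have hE := h.integral_exp hcov₁ hcov₂ hR
  have he₁ (t : Fin d₁ → ℝ) : MemLp (fun ω => Real.exp (t ⬝ᵥ Y₁ ω - t ⬝ᵥ t / 2)) 2 μ := by
    rw [memLp_two_iff_integrable_sq (by simp only [dotProduct]; fun_prop)]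
    convert! (hE ((2 : ℝ) • t) 0).1.const_mul (Real.exp (-(t ⬝ᵥ t))) using 2 with ω
    rw [← Real.exp_add, sq, ← Real.exp_add]
    congr 1
    simp
    ring
  have he₂ (t : Fin d₂ → ℝ) : MemLp (fun ω => Real.exp (t ⬝ᵥ Y₂ ω - t ⬝ᵥ t / 2)) 2 μ := by
    rw [memLp_two_iff_integrable_sq (by simp only [dotProduct]; fun_prop)]
    convert! (hE 0 ((2 : ℝ) • t)).1.const_mul (Real.exp (-(t ⬝ᵥ t))) using 2 with ω
    rw [← Real.exp_add, sq, ← Real.exp_add]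
    congr 1
    simp
    ring
  have hone : MemLp (fun _ : Ω => (1 : ℝ)) 2 μ := memLp_const 1
  have hexp (t t' : Fin d₁ → ℝ) (u u' : Fin d₂ → ℝ) (c x : ℝ) (F : Ω → ℝ)
      (hF : ∀ ω, F ω = Real.exp ((t + t') ⬝ᵥ Y₁ ω + (u + u') ⬝ᵥ Y₂ ω - c))
      (hc : ((t + t') ⬝ᵥ (t + t') + (u + u') ⬝ᵥ (u + u')) / 2 + (t + t') ⬝ᵥ R.mulVec (u + u') =
        c + x) :
      ∫ ω, F ω ∂μ = Real.exp x := by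
    simp_rw [hF, Real.exp_sub]
    rw [integral_div, (hE _ _).2, ← Real.exp_sub, hc, add_sub_cancel_left]
  have ho₁ (t) : ⟪hone.toLp, (he₁ t).toLp⟫ = 1 := by
    rw [MemLp.inner_toLp, ← Real.exp_zero]
    refine hexp t 0 0 0 (t ⬝ᵥ t / 2) 0 _ (fun ω => ?_) ?_ <;> simp
  have ho₂ (u) : ⟪hone.toLp, (he₂ u).toLp⟫ = 1 := by
    rw [MemLp.inner_toLp, ← Real.exp_zero]
    refine hexp 0 0 u 0 (u ⬝ᵥ u / 2) 0 _ (fun ω => ?_) ?_ <;> simp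
  have h₁₁ (t t') : ⟪(he₁ t).toLp, (he₁ t').toLp⟫ = Real.exp (t ⬝ᵥ t') := by
    rw [MemLp.inner_toLp]
    refine hexp t t' 0 0 (t ⬝ᵥ t / 2 + t' ⬝ᵥ t' / 2) _ _ (fun ω => ?_) ?_
    · rw [← Real.exp_add]; congr 1; simp [add_dotProduct]; ring
    · simp [add_dotProduct, dotProduct_comm t' t]; ring
  have h₂₂ (u u') : ⟪(he₂ u).toLp, (he₂ u').toLp⟫ = Real.exp (u ⬝ᵥ u') := by
    rw [MemLp.inner_toLp]
    refine hexp 0 0 u u' (u ⬝ᵥ u / 2 + u' ⬝ᵥ u' / 2) _ _ (fun ω => ?_) ?_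
    · rw [← Real.exp_add]; congr 1; simp [add_dotProduct]; ring
    · simp [add_dotProduct, dotProduct_comm u' u]; ring
  have h₁₂ (t u) : ⟪(he₁ t).toLp, (he₂ u).toLp⟫ = Real.exp (t ⬝ᵥ R.mulVec u) := by
    rw [MemLp.inner_toLp]
    refine hexp t 0 u 0 (t ⬝ᵥ t / 2 + u ⬝ᵥ u / 2) _ _ (fun ω => ?_) ?_
    · rw [← Real.exp_add]; congr 1; simp; ring
    · simp; ring
  have key := inner_nonneg_of_posSemidef_fromBlocks hone.toLp
    (by rw [MemLp.inner_toLp]; simp) s (e₁ := fun t => (he₁ t).toLp) (e₂ := fun u => (he₂ u).toLp)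
    (by simpa only [ho₁, ho₂, h₁₁, h₂₂, h₁₂, mul_one] using R.posSemidef_exp_kernel hs0 hs1 hs)
    (hL₁.toLp_comp_mem_topologicalClosure_span_exp hY₁ hφ₁ he₁)
    (hL₂.toLp_comp_mem_topologicalClosure_span_exp hY₂ hφ₂ he₂)
    (by rw [MemLp.inner_toLp]; simpa using hcent₁) (by rw [MemLp.inner_toLp]; simpa using hcent₂)
  simpa only [MemLp.inner_toLp, ← sq] using key

/-- **Two-vector decoupling.** For a jointly Gaussian pair of standard Gaussian vectors with
cross-correlation matrix `R` whose largest singular value is `s`, the decoupling inequality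
`(1 - s)(‖φ₁‖₂² + ‖φ₂‖₂²) ≤ ‖φ₁ + φ₂‖₂² ≤ (1 + s)(‖φ₁‖₂² + ‖φ₂‖₂²)` holds for all
measurable centered square-integrable `φ₁(Y₁)`, `φ₂(Y₂)`. -/
theorem decoupling_two_gaussian_vectors
    {Ω : Type*} [MeasurableSpace Ω] (μ : Measure Ω) [IsProbabilityMeasure μ]
    {d₁ d₂ : ℕ} (Y₁ : Ω → Fin d₁ → ℝ) (Y₂ : Ω → Fin d₂ → ℝ)
    (hGauss : IsJointGaussianPair μ Y₁ Y₂)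
    (hmean₁ : ∀ i, ∫ ω, Y₁ ω i ∂μ = 0)
    (hmean₂ : ∀ j, ∫ ω, Y₂ ω j ∂μ = 0)
    (hcov₁ : ∀ i j, ∫ ω, Y₁ ω i * Y₁ ω j ∂μ = if i = j then 1 else 0)
    (hcov₂ : ∀ i j, ∫ ω, Y₂ ω i * Y₂ ω j ∂μ = if i = j then 1 else 0)
    (R : Matrix (Fin d₁) (Fin d₂) ℝ)
    (hR : ∀ i j, R i j = ∫ ω, Y₁ ω i * Y₂ ω j ∂μ)
    (s : ℝ) (hs0 : 0 ≤ s)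
    (hsEig : ∃ v : Fin d₂ → ℝ, v ≠ 0 ∧ (R.transpose * R).mulVec v = s ^ 2 • v)
    (hsMax : ∀ (t : ℝ) (v : Fin d₂ → ℝ), v ≠ 0 → (R.transpose * R).mulVec v = t • v →
      t ≤ s ^ 2)
    (φ₁ : (Fin d₁ → ℝ) → ℝ) (φ₂ : (Fin d₂ → ℝ) → ℝ)
    (hφ₁ : Measurable φ₁) (hφ₂ : Measurable φ₂)
    (hcent₁ : ∫ ω, φ₁ (Y₁ ω) ∂μ = 0) (hcent₂ : ∫ ω, φ₂ (Y₂ ω) ∂μ = 0)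
    (hL₁ : Integrable (fun ω => (φ₁ (Y₁ ω)) ^ 2) μ)
    (hL₂ : Integrable (fun ω => (φ₂ (Y₂ ω)) ^ 2) μ) :
    (1 - s) * ((∫ ω, (φ₁ (Y₁ ω)) ^ 2 ∂μ) + ∫ ω, (φ₂ (Y₂ ω)) ^ 2 ∂μ) ≤
        ∫ ω, (φ₁ (Y₁ ω) + φ₂ (Y₂ ω)) ^ 2 ∂μ ∧
      ∫ ω, (φ₁ (Y₁ ω) + φ₂ (Y₂ ω)) ^ 2 ∂μ ≤
        (1 + s) * ((∫ ω, (φ₁ (Y₁ ω)) ^ 2 ∂μ) + ∫ ω, (φ₂ (Y₂ ω)) ^ 2 ∂μ) := by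
  have hY₁ : AEMeasurable Y₁ μ :=
    aemeasurable_pi_iff.mpr fun i => (hGauss.memLp_left i).aemeasurable
  have hY₂ : AEMeasurable Y₂ μ :=
    aemeasurable_pi_iff.mpr fun i => (hGauss.memLp_right i).aemeasurable
  have hM₁ : MemLp (fun ω => φ₁ (Y₁ ω)) 2 μ :=
    (memLp_two_iff_integrable_sq (hφ₁.comp_aemeasurable hY₁).aestronglyMeasurable).mpr hL₁
  have hM₂ : MemLp (fun ω => φ₂ (Y₂ ω)) 2 μ :=
    (memLp_two_iff_integrable_sq (hφ₂.comp_aemeasurable hY₂).aestronglyMeasurable).mpr hL₂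
  have hprod : Integrable (fun ω => φ₁ (Y₁ ω) * φ₂ (Y₂ ω)) μ := hM₁.integrable_mul hM₂
  have hsum : Integrable (fun ω => φ₁ (Y₁ ω) ^ 2 + φ₂ (Y₂ ω) ^ 2) μ := hL₁.add hL₂
  have hadd : ∫ ω, (φ₁ (Y₁ ω) + φ₂ (Y₂ ω)) ^ 2 ∂μ =
      (∫ ω, (φ₁ (Y₁ ω)) ^ 2 ∂μ) + (∫ ω, (φ₂ (Y₂ ω)) ^ 2 ∂μ) +
        2 * ∫ ω, φ₁ (Y₁ ω) * φ₂ (Y₂ ω) ∂μ := by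
    rw [← integral_const_mul, ← integral_add hL₁ hL₂,
      ← integral_add hsum (hprod.const_mul 2)]
    exact integral_congr_ae (.of_forall fun ω => by ring)
  have hsub : ∫ ω, (φ₁ (Y₁ ω) - φ₂ (Y₂ ω)) ^ 2 ∂μ =
      (∫ ω, (φ₁ (Y₁ ω)) ^ 2 ∂μ) + (∫ ω, (φ₂ (Y₂ ω)) ^ 2 ∂μ) -
        2 * ∫ ω, φ₁ (Y₁ ω) * φ₂ (Y₂ ω) ∂μ := by
    rw [← integral_const_mul, ← integral_add hL₁ hL₂,
      ← integral_sub hsum (hprod.const_mul 2)]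
    exact integral_congr_ae (.of_forall fun ω => by ring)
  rcases le_total s 1 with hs1 | hs1
  · have hpos := hGauss.integral_mul_nonneg hcov₁ hcov₂ hR hs0 hs1 hsMax hφ₁ hφ₂ hcent₁ hcent₂
      hM₁ hM₂
    have hneg := hGauss.integral_mul_nonneg hcov₁ hcov₂ hR hs0 hs1 hsMax hφ₁ hφ₂.neg hcent₁
      (by simpa [integral_neg] using hcent₂) hM₁ hM₂.neg
    simp only [Pi.neg_apply, neg_sq, mul_neg, integral_neg] at hneg
    constructor <;> linarith
  · have hadd0 : 0 ≤ ∫ ω, (φ₁ (Y₁ ω) + φ₂ (Y₂ ω)) ^ 2 ∂μ :=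
      integral_nonneg fun ω => sq_nonneg _
    have hsub0 : 0 ≤ ∫ ω, (φ₁ (Y₁ ω) - φ₂ (Y₂ ω)) ^ 2 ∂μ :=
      integral_nonneg fun ω => sq_nonneg _
    have h1 : 0 ≤ ∫ ω, (φ₁ (Y₁ ω)) ^ 2 ∂μ := integral_nonneg fun ω => sq_nonneg _
    have h2 : 0 ≤ ∫ ω, (φ₂ (Y₂ ω)) ^ 2 ∂μ := integral_nonneg fun ω => sq_nonneg _
    constructor <;> nlinarith
end

section
/- Let Ȳ_1, …, Ȳ_N be jointly Gaussian random vectors, Ȳ_α = (Y_{α,i})_{i=1,…,d_α}, such that each Ȳ_α is a standard Gaussian vector (E[Y_{α,i}] = 0, E[Y_{α,i} Y_{α,j}] = δ_{ij}), and E[Y_{α,i} Y_{β,j}] = ρ^{α,β}_{i,j} for α ≠ β. For α ≠ β let s*_{α,β} be the largest singular value of the matrix R^{α,β} = (ρ^{α,β}_{i,j})_{i,j}, set s*_{α,α} = 0, and let σ_0 be the largest eigenvalue of the symmetric N×N matrix S* = (s*_{α,β}). Set C_± = 1 ± σ_0. Then for all measurable functions φ_α : R^{d_α} → R with E[φ_α(Ȳ_α)]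 = 0 and φ_α(Ȳ_α) square-integrable (α = 1, …, N), one has C_- Σ_{α=1}^N ‖φ_α(Ȳ_α)‖_2^2 ≤ ‖Σ_{α=1}^N φ_α(Ȳ_α)‖_2^2 ≤ C_+ Σ_{α=1}^N ‖φ_α(Ȳ_α)‖_2^2. -/
open MeasureTheory ProbabilityTheory
open scoped NNReal

/-- A family of random vectors `Y α : Ω → Fin (d α) → ℝ` is jointly centered Gaussian if every
linear combination of all their coordinates has a centered Gaussian law. -/
def IsJointGaussianFamily {Ω : Type*} [MeasurableSpace Ω] (μ : Measure Ω) {N : ℕ}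
    {d : Fin N → ℕ} (Y : (α : Fin N) → Ω → Fin (d α) → ℝ) : Prop :=
  ∀ c : (α : Fin N) → Fin (d α) → ℝ, ∃ v : ℝ≥0,
    Measure.map (fun ω => ∑ α, ∑ i, c α i * Y α ω i) μ = gaussianReal 0 v

section Decorrelation

theorem le_mul_of_sq_le_mul_of_le_geometric {a : ℕ → ℝ} {C q : ℝ} (hq : 0 ≤ q)
    (ha : ∀ n, 0 ≤ a n) (hconv : ∀ n, a (n + 1) ^ 2 ≤ a n * a (n + 2))
    (hbound : ∀ n, a n ≤ C * q ^ n) : a 1 ≤ q * a 0 := by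
  by_contra! hlt
  have h0 : 0 < a 0 := by
    rcases (ha 0).eq_or_lt with h | h
    · have h1 := hconv 0
      rw [← h] at h1 hlt
      simp only [zero_add, zero_mul, mul_zero] at h1 hlt
      nlinarith
    · exact h
  set r := a 1 / a 0 with hr
  have hqr : q < r := by rwa [hr, lt_div_iff₀ h0]
  have hr0 : 0 < r := hq.trans_lt hqr
  have hstep : ∀ n, 0 < a n ∧ r * a n ≤ a (n + 1) := by
    intro n
    induction n with
    | zero => exact ⟨h0, by rw [hr]; field_simp; rfl⟩
    | succ n ih =>
      have hpos : 0 < a (n + 1) := (mul_pos hr0 ih.1).trans_le ih.2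
      refine ⟨hpos, ?_⟩
      have h1 := hconv n
      have h2 : a (n + 1) * (r * a n) ≤ a (n + 1) * a (n + 1) :=
        mul_le_mul_of_nonneg_left ih.2 hpos.le
      have h3 : a n * (r * a (n + 1)) ≤ a n * a (n + 2) := by nlinarith
      exact le_of_mul_le_mul_left h3 ih.1
  have hgeo : ∀ n, a 0 * r ^ n ≤ a n := by
    intro n
    induction n with
    | zero => simp
    | succ n ih =>
      calc a 0 * r ^ (n + 1) = r * (a 0 * r ^ n) := by ring
        _ ≤ r * a n := by gcongr
        _ ≤ a (n + 1) := (hstep n).2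
  have hlim : Filter.Tendsto (fun n : ℕ => C * (q / r) ^ n) Filter.atTop (nhds (C * 0)) :=
    (tendsto_pow_atTop_nhds_zero_of_lt_one (by positivity)
      ((div_lt_one hr0).2 hqr)).const_mul C
  have hle : a 0 ≤ C * 0 := by
    refine ge_of_tendsto' hlim fun n => ?_
    rw [div_pow, ← mul_div_assoc, le_div_iff₀ (by positivity)]
    exact (hgeo n).trans (hbound n)
  linarith

variable {Ω : Type*} [MeasurableSpace Ω] {μ : Measure Ω}

theorem inner_toLp_eq_integral_mul {u v : Ω → ℝ} (hu : MemLp u 2 μ) (hv : MemLp v 2 μ) :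
    inner ℝ (hu.toLp u) (hv.toLp v) = ∫ ω, u ω * v ω ∂μ := by
  rw [L2.inner_def]
  refine integral_congr_ae ?_
  filter_upwards [hu.coeFn_toLp, hv.coeFn_toLp] with ω h1 h2
  simp [h1, h2, mul_comm]

theorem norm_toLp_sq_eq_integral_sq {u : Ω → ℝ} (hu : MemLp u 2 μ) :
    ‖hu.toLp u‖ ^ 2 = ∫ ω, u ω ^ 2 ∂μ := by
  rw [← real_inner_self_eq_norm_sq, inner_toLp_eq_integral_mul]
  simp only [sq]

theorem sq_integral_mul_le {u v : Ω → ℝ} (hu : MemLp u 2 μ) (hv : MemLp v 2 μ) :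
    (∫ ω, u ω * v ω ∂μ) ^ 2 ≤ (∫ ω, u ω ^ 2 ∂μ) * ∫ ω, v ω ^ 2 ∂μ := by
  rw [← inner_toLp_eq_integral_mul hu hv, ← norm_toLp_sq_eq_integral_sq hu,
    ← norm_toLp_sq_eq_integral_sq hv, ← mul_pow, ← sq_abs]
  gcongr
  exact abs_real_inner_le_norm _ _

theorem LipschitzWith.memLp_comp [IsFiniteMeasure μ] {F : Type*} [NormedAddCommGroup F]
    {g : F → ℝ} {K : ℝ≥0} (hg : LipschitzWith K g) {Y : Ω → F} {p : ENNReal} (hY : MemLp Y p μ) :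
    MemLp (fun ω => g (Y ω)) p μ := by
  have h := (LipschitzWith.comp_memLp (g := fun y => g y - g 0)
    (by simpa using hg.sub (LipschitzWith.const (g 0))) (by simp) hY).add (memLp_const (g 0))
  convert! h using 1
  ext ω
  simp

theorem LipschitzWith.integral_sq_comp_le [IsProbabilityMeasure μ]
    {F : Type*} [NormedAddCommGroup F] {Y : Ω → F} (hY : MemLp Y 2 μ)
    {g : F → ℝ} {K : ℝ≥0} (hg : LipschitzWith K g) (hcent : ∫ ω, g (Y ω) ∂μ = 0) :
    ∫ ω, g (Y ω) ^ 2 ∂μ ≤ (∫ ω, ‖Y ω‖ ^ 2 ∂μ) * (K : ℝ) ^ 2 := by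
  have hgY := hg.memLp_comp hY
  have hgi := hgY.integrable (by norm_num)
  have hsq : Integrable (fun ω => (g (Y ω) - g 0) ^ 2) μ :=
    (hgY.sub (memLp_const (g 0))).integrable_sq
  have h1 : ∫ ω, (g (Y ω) - g 0) ^ 2 ∂μ = ∫ ω, g (Y ω) ^ 2 ∂μ + g 0 ^ 2 := by
    have : ∀ ω, (g (Y ω) - g 0) ^ 2 = g (Y ω) ^ 2 - 2 * g 0 * g (Y ω) + g 0 ^ 2 := fun ω => by
      ring
    simp only [this]
    have hlin : Integrable (fun ω => g (Y ω) ^ 2 - 2 * g 0 * g (Y ω)) μ :=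
      hgY.integrable_sq.sub (hgi.const_mul _)
    rw [integral_add hlin (integrable_const _),
      integral_sub hgY.integrable_sq (hgi.const_mul _), integral_const_mul, hcent]
    simp
  have h2 : ∫ ω, (g (Y ω) - g 0) ^ 2 ∂μ ≤ ∫ ω, ‖Y ω‖ ^ 2 * (K : ℝ) ^ 2 ∂μ := by
    refine integral_mono hsq (hY.norm.integrable_sq.mul_const _) fun ω => ?_
    have := hg.dist_le_mul (Y ω) 0
    rw [Real.dist_eq, dist_zero_right] at this
    calc (g (Y ω) - g 0) ^ 2 = |g (Y ω) - g 0| ^ 2 := (sq_abs _).symm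
      _ ≤ (K * ‖Y ω‖) ^ 2 := by gcongr
      _ = _ := by ring
  rw [integral_mul_const] at h2
  nlinarith [sq_nonneg (g 0)]

variable {E F : Type*} [NormedAddCommGroup E] [NormedSpace ℝ E] [NormedAddCommGroup F]
  [NormedSpace ℝ F] [MeasurableSpace F]

/-- The average of `g` over the translates of `ν` by `L x`. -/
noncomputable def translateAverage (L : E →L[ℝ] F) (ν : Measure F) (g : F → ℝ) (x : E) : ℝ :=
  ∫ w, g (L x + w) ∂ν

theorem LipschitzWith.translateAverage {L : E →L[ℝ] F} {s : ℝ≥0} (hL : ‖L‖₊ ≤ s)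
    {ν : Measure F} [IsProbabilityMeasure ν] (hν : MemLp id 2 ν) {g : F → ℝ} {K : ℝ≥0}
    (hg : LipschitzWith K g) : LipschitzWith (s * K) (translateAverage L ν g) := by
  have hint : ∀ x, Integrable (fun w => g (L x + w)) ν := fun x =>
    (hg.memLp_comp ((memLp_const (L x)).add hν)).integrable (by norm_num)
  refine LipschitzWith.of_dist_le_mul fun x y => ?_
  rw [Real.dist_eq, _root_.translateAverage, _root_.translateAverage,
    ← integral_sub (hint x) (hint y)]
  have hb : ∀ w, ‖g (L x + w) - g (L y + w)‖ ≤ s * K * dist x y := by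
    intro w
    rw [← dist_eq_norm]
    calc dist (g (L x + w)) (g (L y + w)) ≤ K * dist (L x + w) (L y + w) := hg.dist_le_mul _ _
      _ = K * dist (L x) (L y) := by simp
      _ ≤ K * (s * dist x y) := by
        gcongr
        exact (L.lipschitz.weaken hL).dist_le_mul x y
      _ = s * K * dist x y := by ring
  simpa using norm_integral_le_of_norm_le_const (μ := ν) (Filter.Eventually.of_forall hb)

variable [MeasurableSpace E] [BorelSpace E] [BorelSpace F] [FiniteDimensional ℝ F]

theorem integral_mul_comp_eq_integral_mul_translateAverage [IsProbabilityMeasure μ]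
    {X : Ω → E} {Y : Ω → F} {L : E →L[ℝ] F} (hX : AEMeasurable X μ) (hY : AEMeasurable Y μ)
    (hind : IndepFun X (fun ω => Y ω - L (X ω)) μ) {h : E → ℝ} {g : F → ℝ}
    (hh : Measurable h) (hg : Measurable g)
    (hint : Integrable (fun ω => h (X ω) * g (Y ω)) μ) :
    ∫ ω, h (X ω) * g (Y ω) ∂μ =
      ∫ ω, h (X ω) * translateAverage L (μ.map fun ω => Y ω - L (X ω)) g (X ω) ∂μ := by
  have hW : AEMeasurable (fun ω => Y ω - L (X ω)) μ :=
    hY.sub (L.continuous.measurable.comp_aemeasurable hX)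
  have hXW := hX.prodMk hW
  have hmap := hind.map_prod_eq_prod_map_map hX hW
  set ν := μ.map fun ω => Y ω - L (X ω) with hν
  have : IsProbabilityMeasure ν := Measure.isProbabilityMeasure_map hW
  have : IsProbabilityMeasure (μ.map X) := Measure.isProbabilityMeasure_map hX
  let k : E × F → ℝ := fun z => h z.1 * g (L z.1 + z.2)
  have hk : Measurable k := by
    refine (hh.comp measurable_fst).mul (hg.comp ?_)
    exact (L.continuous.measurable.comp measurable_fst).add measurable_snd
  have hcomp : (fun ω => h (X ω) * g (Y ω)) = fun ω => k (X ω, Y ω - L (X ω)) := by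
    ext ω
    simp [k]
  rw [hcomp] at hint ⊢
  have hintk : Integrable k ((μ.map X).prod ν) := by
    rw [← hmap]
    exact (integrable_map_measure hk.aestronglyMeasurable hXW).2 hint
  rw [← integral_map hXW hk.aestronglyMeasurable, hmap, integral_prod _ hintk]
  have hm : AEStronglyMeasurable (fun x => ∫ w, k (x, w) ∂ν) (μ.map X) :=
    hk.stronglyMeasurable.integral_prod_right.aestronglyMeasurable
  rw [integral_map hX hm]
  simp only [k, translateAverage, integral_const_mul]

variable [FiniteDimensional ℝ E]

/-- If `Y - L X` is independent of `X` and `X - M Y` is independent of `Y`, with `‖L‖, ‖M‖ ≤ s`,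
then conditioning on `X` contracts centered Lipschitz functions of `Y` by `s` in `L²`. The composite
`A` of the two conditionings is symmetric, so `n ↦ ‖A ^ n f‖` is log-convex, while it decays like
`s ^ (2 * n)` because each conditioning contracts Lipschitz constants by `s`. -/
theorem integral_sq_translateAverage_le [IsProbabilityMeasure μ]
    {X : Ω → E} {Y : Ω → F} (hX : MemLp X 2 μ) (hY : MemLp Y 2 μ)
    {L : E →L[ℝ] F} {M : F →L[ℝ] E} {s : ℝ≥0} (hL : ‖L‖₊ ≤ s) (hM : ‖M‖₊ ≤ s)
    (hindX : IndepFun X (fun ω => Y ω - L (X ω)) μ)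
    (hindY : IndepFun Y (fun ω => X ω - M (Y ω)) μ)
    {f : F → ℝ} {K : ℝ≥0} (hf : LipschitzWith K f) (hcent : ∫ ω, f (Y ω) ∂μ = 0) :
    ∫ ω, translateAverage L (μ.map fun ω => Y ω - L (X ω)) f (X ω) ^ 2 ∂μ ≤
      (s : ℝ) ^ 2 * ∫ ω, f (Y ω) ^ 2 ∂μ := by
  have hXm := hX.aestronglyMeasurable.aemeasurable
  have hYm := hY.aestronglyMeasurable.aemeasurable
  have hU : MemLp (fun ω => Y ω - L (X ω)) 2 μ := hY.sub (L.comp_memLp' hX)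
  have hV : MemLp (fun ω => X ω - M (Y ω)) 2 μ := hX.sub (M.comp_memLp' hY)
  set ν := μ.map fun ω => Y ω - L (X ω)
  set η := μ.map fun ω => X ω - M (Y ω)
  have hUm := hU.aestronglyMeasurable.aemeasurable
  have hVm := hV.aestronglyMeasurable.aemeasurable
  have : IsProbabilityMeasure ν := Measure.isProbabilityMeasure_map hUm
  have : IsProbabilityMeasure η := Measure.isProbabilityMeasure_map hVm
  have hν : MemLp id 2 ν :=
    (memLp_map_measure_iff aestronglyMeasurable_id hUm).2 hU
  have hη : MemLp id 2 η :=
    (memLp_map_measure_iff aestronglyMeasurable_id hVm).2 hV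
  let T : (F → ℝ) → E → ℝ := translateAverage L ν
  let S : (E → ℝ) → F → ℝ := translateAverage M η
  have hT : ∀ {g : F → ℝ} {K : ℝ≥0}, LipschitzWith K g → LipschitzWith (s * K) (T g) :=
    fun hg => hg.translateAverage hL hν
  have hS : ∀ {g : E → ℝ} {K : ℝ≥0}, LipschitzWith K g → LipschitzWith (s * K) (S g) :=
    fun hg => hg.translateAverage hM hη
  have hTadj : ∀ {h : E → ℝ} {g : F → ℝ} {K K' : ℝ≥0}, LipschitzWith K' h → LipschitzWith K g →
      ∫ ω, h (X ω) * g (Y ω) ∂μ = ∫ ω, h (X ω) * T g (X ω) ∂μ := fun hh hg =>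
    integral_mul_comp_eq_integral_mul_translateAverage hXm hYm hindX hh.continuous.measurable
      hg.continuous.measurable ((hh.memLp_comp hX).integrable_mul (hg.memLp_comp hY))
  have hSadj : ∀ {h : E → ℝ} {g : F → ℝ} {K K' : ℝ≥0}, LipschitzWith K' h → LipschitzWith K g →
      ∫ ω, g (Y ω) * h (X ω) ∂μ = ∫ ω, g (Y ω) * S h (Y ω) ∂μ := fun hh hg =>
    integral_mul_comp_eq_integral_mul_translateAverage hYm hXm hindY hg.continuous.measurable
      hh.continuous.measurable ((hg.memLp_comp hY).integrable_mul (hh.memLp_comp hX))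
  have hsymm : ∀ {u v : F → ℝ} {K K' : ℝ≥0}, LipschitzWith K u → LipschitzWith K' v →
      ∫ ω, u (Y ω) * S (T v) (Y ω) ∂μ = ∫ ω, T u (X ω) * T v (X ω) ∂μ := fun hu hv => by
    rw [← hSadj (hT hv) hu]
    exact (integral_congr_ae (.of_forall fun ω => mul_comm _ _)).trans
      ((hTadj (hT hv) hu).trans (integral_congr_ae (.of_forall fun ω => mul_comm _ _)))
  let g : ℕ → F → ℝ := fun n => (fun u => S (T u))^[n] f
  have hgsucc : ∀ n, g (n + 1) = S (T (g n)) := fun n => Function.iterate_succ_apply' _ n f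
  have hglip : ∀ n, LipschitzWith ((s * s) ^ n * K) (g n) := by
    intro n
    induction n with
    | zero => simpa [g] using hf
    | succ n ih =>
      rw [hgsucc]
      convert hS (hT ih) using 1
      ring
  have hgcent : ∀ n, ∫ ω, g n (Y ω) ∂μ = 0 := by
    intro n
    induction n with
    | zero => simpa [g] using hcent
    | succ n ih =>
      have h1 := hSadj (hT (hglip n)) (LipschitzWith.const (1 : ℝ))
      have h2 := hTadj (LipschitzWith.const (1 : ℝ)) (hglip n)
      simp only [one_mul] at h1 h2
      rw [hgsucc, ← h1, ← h2, ih]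
  have hgY : ∀ n, MemLp (fun ω => g n (Y ω)) 2 μ := fun n => (hglip n).memLp_comp hY
  have hconv : ∀ n, (∫ ω, g (n + 1) (Y ω) ^ 2 ∂μ) ^ 2 ≤
      (∫ ω, g n (Y ω) ^ 2 ∂μ) * ∫ ω, g (n + 2) (Y ω) ^ 2 ∂μ := by
    intro n
    have h1 : ∫ ω, g (n + 1) (Y ω) ^ 2 ∂μ = ∫ ω, g n (Y ω) * g (n + 2) (Y ω) ∂μ := by
      rw [hgsucc (n + 1), hsymm (hglip n) (hglip (n + 1))]
      simp_rw [mul_comm (T (g n) _)]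
      rw [← hsymm (hglip (n + 1)) (hglip n), ← hgsucc]
      simp only [sq]
    rw [h1]
    exact sq_integral_mul_le (hgY n) (hgY (n + 2))
  have hbound : ∀ n, ∫ ω, g n (Y ω) ^ 2 ∂μ ≤
      ((∫ ω, ‖Y ω‖ ^ 2 ∂μ) * (K : ℝ) ^ 2) * ((s : ℝ) ^ 4) ^ n := by
    intro n
    refine ((hglip n).integral_sq_comp_le hY (hgcent n)).trans_eq ?_
    push_cast
    ring
  have hfirst := le_mul_of_sq_le_mul_of_le_geometric (by positivity)
    (fun n => integral_nonneg fun ω => sq_nonneg (g n (Y ω))) hconv hbound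
  have hTf : ∫ ω, T f (X ω) ^ 2 ∂μ = ∫ ω, g 0 (Y ω) * g 1 (Y ω) ∂μ := by
    rw [hgsucc 0]
    simp only [g, Function.iterate_zero, id]
    rw [hsymm hf hf]
    simp only [sq]
  have hf0 : 0 ≤ ∫ ω, f (Y ω) ^ 2 ∂μ := integral_nonneg fun ω => sq_nonneg _
  refine abs_le_of_sq_le_sq' ?_ (by positivity) |>.2
  change (∫ ω, T f (X ω) ^ 2 ∂μ) ^ 2 ≤ _
  rw [hTf]
  calc (∫ ω, g 0 (Y ω) * g 1 (Y ω) ∂μ) ^ 2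
      ≤ (∫ ω, f (Y ω) ^ 2 ∂μ) * ∫ ω, g 1 (Y ω) ^ 2 ∂μ := sq_integral_mul_le (hgY 0) (hgY 1)
    _ ≤ (∫ ω, f (Y ω) ^ 2 ∂μ) * ((s : ℝ) ^ 4 * ∫ ω, f (Y ω) ^ 2 ∂μ) := by
      gcongr
      exact hfirst
    _ = ((s : ℝ) ^ 2 * ∫ ω, f (Y ω) ^ 2 ∂μ) ^ 2 := by ring

theorem abs_integral_mul_le_of_lipschitz [IsProbabilityMeasure μ]
    {X : Ω → E} {Y : Ω → F} (hX : MemLp X 2 μ) (hY : MemLp Y 2 μ)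
    {L : E →L[ℝ] F} {M : F →L[ℝ] E} {s : ℝ≥0} (hL : ‖L‖₊ ≤ s) (hM : ‖M‖₊ ≤ s)
    (hindX : IndepFun X (fun ω => Y ω - L (X ω)) μ)
    (hindY : IndepFun Y (fun ω => X ω - M (Y ω)) μ)
    {h : E → ℝ} (hh : Measurable h) (hhX : MemLp (fun ω => h (X ω)) 2 μ)
    {f : F → ℝ} {K : ℝ≥0} (hf : LipschitzWith K f) (hcent : ∫ ω, f (Y ω) ∂μ = 0) :
    |∫ ω, h (X ω) * f (Y ω) ∂μ| ≤
      s * (√(∫ ω, h (X ω) ^ 2 ∂μ) * √(∫ ω, f (Y ω) ^ 2 ∂μ)) := by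
  have hU : MemLp (fun ω => Y ω - L (X ω)) 2 μ := hY.sub (L.comp_memLp' hX)
  have hUm := hU.aestronglyMeasurable.aemeasurable
  have : IsProbabilityMeasure (μ.map fun ω => Y ω - L (X ω)) :=
    Measure.isProbabilityMeasure_map hUm
  have hTlip := hf.translateAverage hL
    ((memLp_map_measure_iff aestronglyMeasurable_id hUm).2 hU)
  have hbound := integral_sq_translateAverage_le hX hY hL hM hindX hindY hf hcent
  rw [integral_mul_comp_eq_integral_mul_translateAverage hX.aestronglyMeasurable.aemeasurable
    hY.aestronglyMeasurable.aemeasurable hindX hh hf.continuous.measurable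
    (hhX.integrable_mul (hf.memLp_comp hY))]
  have hf0 : 0 ≤ ∫ ω, f (Y ω) ^ 2 ∂μ := integral_nonneg fun ω => sq_nonneg _
  have hh0 : 0 ≤ ∫ ω, h (X ω) ^ 2 ∂μ := integral_nonneg fun ω => sq_nonneg _
  refine abs_le_of_sq_le_sq ((sq_integral_mul_le hhX (hTlip.memLp_comp hX)).trans ?_)
    (by positivity)
  rw [mul_pow, mul_pow, Real.sq_sqrt hh0, Real.sq_sqrt hf0, mul_left_comm]
  exact mul_le_mul_of_nonneg_left hbound hh0

theorem abs_integral_mul_le_of_indepFun_sub [IsProbabilityMeasure μ]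
    {X : Ω → E} {Y : Ω → F} (hX : MemLp X 2 μ) (hY : MemLp Y 2 μ)
    {L : E →L[ℝ] F} {M : F →L[ℝ] E} {s : ℝ≥0} (hL : ‖L‖₊ ≤ s) (hM : ‖M‖₊ ≤ s)
    (hindX : IndepFun X (fun ω => Y ω - L (X ω)) μ)
    (hindY : IndepFun Y (fun ω => X ω - M (Y ω)) μ)
    {h : E → ℝ} (hh : Measurable h) (hhX : MemLp (fun ω => h (X ω)) 2 μ)
    {f : F → ℝ} (hf : Measurable f) (hfY : MemLp (fun ω => f (Y ω)) 2 μ)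
    (hcent : ∫ ω, f (Y ω) ∂μ = 0) :
    |∫ ω, h (X ω) * f (Y ω) ∂μ| ≤
      s * (√(∫ ω, h (X ω) ^ 2 ∂μ) * √(∫ ω, f (Y ω) ^ 2 ∂μ)) := by
  have hYm := hY.aestronglyMeasurable.aemeasurable
  have : IsProbabilityMeasure (μ.map Y) := Measure.isProbabilityMeasure_map hYm
  have hsqrt : ∀ {u : Ω → ℝ} (hu : MemLp u 2 μ), √(∫ ω, u ω ^ 2 ∂μ) = ‖hu.toLp u‖ := fun hu => by
    rw [← norm_toLp_sq_eq_integral_sq hu, Real.sqrt_sq (norm_nonneg _)]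
  set b := ‖hfY.toLp _‖
  set a := ‖hhX.toLp _‖
  have ha0 : 0 ≤ a := norm_nonneg _
  rw [hsqrt hfY, hsqrt hhX]
  have key : ∀ ε : ℝ, 0 < ε →
      |∫ ω, h (X ω) * f (Y ω) ∂μ| ≤ s * (a * b) + 2 * (a * (s + 1)) * ε := by
    intro ε hε
    have hfmap : MemLp f 2 (μ.map Y) :=
      (memLp_map_measure_iff hf.aestronglyMeasurable hYm).2 hfY
    obtain ⟨g, hgsupp, hgdiff, hgε⟩ := hfmap.exist_eLpNorm_sub_le (by norm_num) (by norm_num) hε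
    obtain ⟨K, hgK⟩ := ContDiff.lipschitzWith_of_hasCompactSupport hgsupp hgdiff (by simp)
    have hgY := hgK.memLp_comp hY
    have hr : MemLp (fun ω => f (Y ω) - g (Y ω)) 2 μ := hfY.sub hgY
    have hrε : ‖hr.toLp _‖ ≤ ε := by
      rw [Lp.norm_toLp]
      refine ENNReal.toReal_le_of_le_ofReal hε.le (le_trans (le_of_eq ?_) hgε)
      rw [eLpNorm_map_measure (hf.sub hgdiff.continuous.measurable).aestronglyMeasurable hYm]
      rfl
    set m := ∫ ω, g (Y ω) ∂μ with hm
    have h1 : MemLp (fun _ : Ω => (1 : ℝ)) 2 μ := memLp_const 1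
    have hm_le : |m| ≤ ε := by
      have hi : ∫ ω, (f (Y ω) - g (Y ω)) * 1 ∂μ = -m := by
        simp only [mul_one]
        rw [integral_sub (hfY.integrable (by norm_num)) (hgY.integrable (by norm_num)), hcent,
          zero_sub]
      rw [← abs_neg, ← hi, ← inner_toLp_eq_integral_mul hr h1]
      refine (abs_real_inner_le_norm _ _).trans ?_
      have : ‖h1.toLp _‖ = 1 := by rw [← hsqrt h1]; simp
      rw [this, mul_one]
      exact hrε
    have hmY : MemLp (fun _ : Ω => m) 2 μ := memLp_const m
    have hm_norm : ‖hmY.toLp _‖ ≤ ε := by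
      rw [← hsqrt hmY]
      simpa [Real.sqrt_sq_eq_abs] using hm_le
    have hcY : MemLp (fun ω => g (Y ω) - m) 2 μ := hgY.sub hmY
    have hdecomp : hfY.toLp _ = hcY.toLp _ + (hr.toLp _ + hmY.toLp _) := by
      rw [← MemLp.toLp_add, ← MemLp.toLp_add]
      congr 1
      ext ω
      simp
    have hrest : ‖hr.toLp _ + hmY.toLp _‖ ≤ 2 * ε := (norm_add_le _ _).trans (by linarith)
    have hcnorm : ‖hcY.toLp _‖ ≤ b + 2 * ε := by
      have : hcY.toLp _ = hfY.toLp _ - (hr.toLp _ + hmY.toLp _) := by rw [hdecomp]; abel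
      rw [this]
      exact (norm_sub_le _ _).trans (by linarith)
    have hclip : LipschitzWith K fun y => g y - m := by
      simpa using hgK.sub (LipschitzWith.const m)
    have hmain := abs_integral_mul_le_of_lipschitz hX hY hL hM hindX hindY hh hhX hclip (by
      rw [integral_sub (hgY.integrable (by norm_num)) (integrable_const _)]
      simp [hm])
    rw [hsqrt hcY, hsqrt hhX, ← inner_toLp_eq_integral_mul hhX hcY] at hmain
    rw [← inner_toLp_eq_integral_mul hhX hfY, hdecomp, inner_add_right]
    calc _ ≤ _ := abs_add_le _ _
      _ ≤ s * (a * (b + 2 * ε)) + a * (2 * ε) := by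
        refine add_le_add (hmain.trans (by gcongr)) ((abs_real_inner_le_norm _ _).trans ?_)
        gcongr
      _ = s * (a * b) + 2 * (a * (s + 1)) * ε := by ring
  refine le_of_forall_pos_le_add fun δ hδ => ?_
  have hC : 0 < 2 * (a * (s + 1)) + 1 := by positivity
  refine (key (δ / (2 * (a * (s + 1)) + 1)) (by positivity)).trans ?_
  gcongr
  rw [← mul_div_assoc, div_le_iff₀ hC]
  nlinarith

theorem ProbabilityTheory.HasGaussianLaw.indepFun_sub_transpose [IsProbabilityMeasure μ] {m n : ℕ}
    {X : Ω → EuclideanSpace ℝ (Fin m)} {Y : Ω → EuclideanSpace ℝ (Fin n)}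
    (hXY : HasGaussianLaw (fun ω => (X ω, Y ω)) μ)
    (hXmean : ∀ i, ∫ ω, X ω i ∂μ = 0)
    (hXcov : ∀ i j, ∫ ω, X ω i * X ω j ∂μ = if i = j then 1 else 0)
    {R : Matrix (Fin m) (Fin n) ℝ} (hR : ∀ i j, R i j = ∫ ω, X ω i * Y ω j ∂μ) :
    IndepFun X (fun ω => Y ω -
      LinearMap.toContinuousLinearMap (Matrix.toLpLin 2 2 R.transpose) (X ω)) μ := by
  set L := LinearMap.toContinuousLinearMap (Matrix.toLpLin 2 2 R.transpose)
  have hX : ∀ i, MemLp (fun ω => X ω i) 2 μ := fun i =>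
    (EuclideanSpace.proj (𝕜 := ℝ) i).comp_memLp' hXY.fst.memLp_two
  have hY : ∀ i, MemLp (fun ω => Y ω i) 2 μ := fun i =>
    (EuclideanSpace.proj (𝕜 := ℝ) i).comp_memLp' hXY.snd.memLp_two
  have hpair : HasGaussianLaw (fun ω => (X ω, Y ω - L (X ω))) μ :=
    hXY.map_fun ((ContinuousLinearMap.fst ℝ _ _).prod
      (ContinuousLinearMap.snd ℝ _ _ - L.comp (ContinuousLinearMap.fst ℝ _ _)))
  have hW : ∀ j, MemLp (fun ω => (Y ω - L (X ω)) j) 2 μ := fun j =>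
    (EuclideanSpace.proj (𝕜 := ℝ) j).comp_memLp' hpair.snd.memLp_two
  have hL : ∀ ω j, L (X ω) j = ∑ k, R k j * X ω k := fun ω j => by
    simp [L, Matrix.mulVec, dotProduct]
  have hcov : ∀ i j, cov[fun ω => X ω i, fun ω => (Y ω - L (X ω)) j; μ] = 0 := by
    intro i j
    rw [covariance_eq_sub (hX i) (hW j), hXmean, zero_mul, sub_zero]
    have : ∀ ω, X ω i * (Y ω - L (X ω)) j = X ω i * Y ω j - ∑ k, R k j * (X ω i * X ω k) := by
      intro ω
      rw [PiLp.sub_apply, hL, mul_sub, Finset.mul_sum]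
      congr 1
      exact Finset.sum_congr rfl fun k _ => by ring
    simp only [Pi.mul_apply, this]
    have hXX : ∀ k, Integrable (fun ω => R k j * (X ω i * X ω k)) μ := fun k =>
      ((hX i).integrable_mul (hX k)).const_mul _
    have hXY' : Integrable (fun ω => X ω i * Y ω j) μ := (hX i).integrable_mul (hY j)
    rw [integral_sub hXY' (integrable_finsetSum _ fun k _ => hXX k),
      integral_finsetSum _ fun k _ => hXX k]
    simp [integral_const_mul, hXcov, ← hR]
  refine hpair.indepFun_of_covariance_inner fun x y => ?_
  have hx : (fun ω => inner ℝ x (X ω)) = fun ω => ∑ i, x i * X ω i := by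
    ext ω
    simp [PiLp.inner_apply, mul_comm]
  have hy : (fun ω => inner ℝ y (Y ω - L (X ω))) = fun ω => ∑ j, y j * (Y ω - L (X ω)) j := by
    ext ω
    simp [PiLp.inner_apply, mul_comm]
  rw [hx, hy, covariance_fun_sum_fun_sum (fun i => (hX i).const_mul _)
    fun j => (hW j).const_mul _]
  simp only [covariance_const_mul_left, covariance_const_mul_right, hcov, mul_zero,
    Finset.sum_const_zero]

open Matrix in
theorem Matrix.IsHermitian.dotProduct_mulVec_le {n : Type*} [Fintype n] [DecidableEq n]
    {A : Matrix n n ℝ} (hA : A.IsHermitian) {t : ℝ}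
    (ht : ∀ (r : ℝ) (v : n → ℝ), v ≠ 0 → A *ᵥ v = r • v → r ≤ t) (x : n → ℝ) :
    x ⬝ᵥ A *ᵥ x ≤ t * (x ⬝ᵥ x) := by
  have hB : (t • (1 : Matrix n n ℝ) - A).IsHermitian :=
    (Matrix.isHermitian_one.smul (IsSelfAdjoint.all t)).sub hA
  have hpos : (t • (1 : Matrix n n ℝ) - A).PosSemidef := by
    rw [hB.posSemidef_iff_eigenvalues_nonneg]
    intro i
    have hev := hB.mulVec_eigenvectorBasis i
    have hne : (⇑(hB.eigenvectorBasis i) : n → ℝ) ≠ 0 := by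
      intro h
      refine hB.eigenvectorBasis.orthonormal.ne_zero i ?_
      ext j
      exact congrFun h j
    rw [sub_mulVec, smul_mulVec, one_mulVec] at hev
    have := ht (t - hB.eigenvalues i) _ hne (by rw [sub_smul, ← hev]; abel)
    simpa using this
  have h := hpos.dotProduct_mulVec_nonneg x
  simp only [star_trivial, sub_mulVec, smul_mulVec, one_mulVec, dotProduct_sub,
    dotProduct_smul, smul_eq_mul] at h
  linarith

open Matrix in
theorem Matrix.norm_toLpLin_le {m n : Type*} [Fintype m] [Fintype n] [DecidableEq n]
    {A : Matrix m n ℝ} {s : ℝ} (hs : 0 ≤ s)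
    (h : ∀ (r : ℝ) (v : n → ℝ), v ≠ 0 → (A.transpose * A) *ᵥ v = r • v → r ≤ s ^ 2) :
    ‖LinearMap.toContinuousLinearMap (Matrix.toLpLin 2 2 A)‖ ≤ s := by
  refine ContinuousLinearMap.opNorm_le_bound _ hs fun x => ?_
  refine le_of_sq_le_sq ?_ (by positivity)
  have hA : (A.transpose * A).IsHermitian := by
    simpa using! isHermitian_conjTranspose_mul_self A
  have h1 := hA.dotProduct_mulVec_le h x.ofLp
  rw [mul_pow, EuclideanSpace.real_norm_sq_eq, EuclideanSpace.real_norm_sq_eq]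
  rw [← mulVec_mulVec, dotProduct_mulVec, vecMul_transpose] at h1
  simpa [dotProduct, sq] using h1

/-- Gebelein's inequality for jointly Gaussian standard Gaussian vectors. -/
theorem abs_integral_mul_le_of_hasGaussianLaw [IsProbabilityMeasure μ] {m n : ℕ}
    {X : Ω → EuclideanSpace ℝ (Fin m)} {Y : Ω → EuclideanSpace ℝ (Fin n)}
    (hXY : HasGaussianLaw (fun ω => (X ω, Y ω)) μ)
    (hXmean : ∀ i, ∫ ω, X ω i ∂μ = 0) (hYmean : ∀ i, ∫ ω, Y ω i ∂μ = 0)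
    (hXcov : ∀ i j, ∫ ω, X ω i * X ω j ∂μ = if i = j then 1 else 0)
    (hYcov : ∀ i j, ∫ ω, Y ω i * Y ω j ∂μ = if i = j then 1 else 0)
    {R : Matrix (Fin m) (Fin n) ℝ} (hR : ∀ i j, R i j = ∫ ω, X ω i * Y ω j ∂μ)
    {s : ℝ≥0} (hsR : ‖LinearMap.toContinuousLinearMap (Matrix.toLpLin 2 2 R)‖₊ ≤ s)
    (hsRt : ‖LinearMap.toContinuousLinearMap (Matrix.toLpLin 2 2 R.transpose)‖₊ ≤ s)
    {h : EuclideanSpace ℝ (Fin m) → ℝ} (hh : Measurable h) (hhX : MemLp (fun ω => h (X ω)) 2 μ)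
    {f : EuclideanSpace ℝ (Fin n) → ℝ} (hf : Measurable f) (hfY : MemLp (fun ω => f (Y ω)) 2 μ)
    (hcent : ∫ ω, f (Y ω) ∂μ = 0) :
    |∫ ω, h (X ω) * f (Y ω) ∂μ| ≤
      s * (√(∫ ω, h (X ω) ^ 2 ∂μ) * √(∫ ω, f (Y ω) ^ 2 ∂μ)) :=
  abs_integral_mul_le_of_indepFun_sub hXY.fst.memLp_two hXY.snd.memLp_two hsRt hsR
    (hXY.indepFun_sub_transpose hXmean hXcov hR)
    ((hXY.map_equiv_fun (ContinuousLinearEquiv.prodComm ℝ _ _)).indepFun_sub_transpose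
      hYmean hYcov (R := R.transpose) (by simp [hR, mul_comm])) hh hhX hf hfY hcent

theorem IsJointGaussianFamily.hasGaussianLaw [IsProbabilityMeasure μ] {N : ℕ} {d : Fin N → ℕ}
    {Y : (α : Fin N) → Ω → Fin (d α) → ℝ} (hY : IsJointGaussianFamily μ Y) :
    HasGaussianLaw (fun ω α => WithLp.toLp 2 (Y α ω)) μ where
  isGaussian_map := by
    have hcoord : ∀ α i, AEMeasurable (fun ω => Y α ω i) μ := by
      intro α i
      obtain ⟨v, hv⟩ := hY (Pi.single α (Pi.single i 1))
      have hsum : (fun ω => ∑ β, ∑ j, (Pi.single α (Pi.single i 1) :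
          (β : Fin N) → Fin (d β) → ℝ) β j * Y β ω j) = fun ω => Y α ω i := by
        ext ω
        rw [Finset.sum_eq_single α, Finset.sum_eq_single i] <;> simp +contextual
      rw [hsum] at hv
      exact AEMeasurable.of_map_ne_zero (hv ▸ IsProbabilityMeasure.ne_zero _)
    have hmeas : AEMeasurable
        (fun ω α => WithLp.toLp 2 (Y α ω) : Ω → (α : Fin N) → EuclideanSpace ℝ (Fin (d α))) μ :=
      aemeasurable_pi_lambda _ fun α =>
        (WithLp.measurable_toLp 2 _).comp_aemeasurable (aemeasurable_pi_lambda _ (hcoord α))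
    refine isGaussian_of_map_eq_gaussianReal fun L => ?_
    obtain ⟨v, hv⟩ := hY fun α i => L (Pi.single α (EuclideanSpace.single i 1))
    refine ⟨0, v, ?_⟩
    rw [AEMeasurable.map_map_of_aemeasurable (by fun_prop) hmeas, ← hv]
    congr 1
    ext ω
    have hdecomp : (fun α => WithLp.toLp 2 (Y α ω) : (α : Fin N) → EuclideanSpace ℝ (Fin (d α)))
        = ∑ α, ∑ i, Y α ω i • Pi.single α (EuclideanSpace.single i 1) := by
      ext β j
      rw [Finset.sum_apply, Finset.sum_eq_single β]
      · simp [Finset.sum_apply, Pi.single_apply]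
      · intro α _ hα
        simp [Finset.sum_apply, Pi.single_eq_of_ne hα.symm]
      · simp
    rw [Function.comp_apply, hdecomp]
    simp [map_sum, mul_comm]

theorem le_of_transpose_mul_self_eigenvalue {m n : Type*} [Fintype m] [Fintype n]
    {A : Matrix m n ℝ} {s t : ℝ} (ht : 0 ≤ t)
    (hs : ∃ v : n → ℝ, v ≠ 0 ∧ (A.transpose * A).mulVec v = s ^ 2 • v)
    (hmax : ∀ (r : ℝ) (v : m → ℝ), v ≠ 0 → (A * A.transpose).mulVec v = r • v → r ≤ t ^ 2) :
    s ≤ t := by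
  obtain ⟨v, hv, hAv⟩ := hs
  by_cases h0 : A.mulVec v = 0
  · rw [← Matrix.mulVec_mulVec, h0, Matrix.mulVec_zero] at hAv
    have : s ^ 2 = 0 := (smul_eq_zero.1 hAv.symm).resolve_right hv
    rw [pow_eq_zero_iff (by norm_num)] at this
    rwa [this]
  · refine le_of_sq_le_sq (hmax _ _ h0 ?_) ht
    rw [Matrix.mulVec_mulVec, Matrix.mul_assoc, ← Matrix.mulVec_mulVec, hAv, Matrix.mulVec_smul]

theorem abs_integral_sq_sum_sub_le [IsProbabilityMeasure μ] {ι : Type*} [Fintype ι]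
    [DecidableEq ι] {u : ι → Ω → ℝ} (hu : ∀ α, MemLp (u α) 2 μ) {s : ι → ι → ℝ}
    (hdiag : ∀ α, s α α = 0)
    (hs : ∀ α β, α ≠ β → |∫ ω, u α ω * u β ω ∂μ| ≤
      s α β * (√(∫ ω, u α ω ^ 2 ∂μ) * √(∫ ω, u β ω ^ 2 ∂μ)))
    {σ : ℝ} (hσ : ∀ x : ι → ℝ, x ⬝ᵥ (Matrix.of s).mulVec x ≤ σ * (x ⬝ᵥ x)) :
    |∫ ω, (∑ α, u α ω) ^ 2 ∂μ - ∑ α, ∫ ω, u α ω ^ 2 ∂μ| ≤ σ * ∑ α, ∫ ω, u α ω ^ 2 ∂μ := by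
  have hint : ∀ α β, Integrable (fun ω => u α ω * u β ω) μ := fun α β =>
    (hu α).integrable_mul (hu β)
  have hexp : ∫ ω, (∑ α, u α ω) ^ 2 ∂μ = ∑ α, ∑ β, ∫ ω, u α ω * u β ω ∂μ := by
    simp only [sq, Finset.sum_mul_sum]
    rw [integral_finsetSum _ fun α _ => integrable_finsetSum _ fun β _ => hint α β]
    exact Finset.sum_congr rfl fun α _ => integral_finsetSum _ fun β _ => hint α β
  have hdiff : ∫ ω, (∑ α, u α ω) ^ 2 ∂μ - ∑ α, ∫ ω, u α ω ^ 2 ∂μ =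
      ∑ α, ∑ β, if α = β then 0 else ∫ ω, u α ω * u β ω ∂μ := by
    rw [hexp, ← Finset.sum_sub_distrib]
    refine Finset.sum_congr rfl fun α _ => ?_
    rw [← Finset.add_sum_erase _ _ (Finset.mem_univ α),
      ← Finset.add_sum_erase Finset.univ (fun β => if α = β then _ else _) (Finset.mem_univ α)]
    simp only [sq, if_true, zero_add, add_sub_cancel_left]
    exact Finset.sum_congr rfl fun β hβ => (if_neg (Finset.ne_of_mem_erase hβ).symm).symm
  have hx := hσ fun α => √(∫ ω, u α ω ^ 2 ∂μ)
  have hnorm : ∀ α, √(∫ ω, u α ω ^ 2 ∂μ) * √(∫ ω, u α ω ^ 2 ∂μ) = ∫ ω, u α ω ^ 2 ∂μ := fun α =>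
    Real.mul_self_sqrt (integral_nonneg fun ω => sq_nonneg _)
  simp only [dotProduct, Matrix.mulVec, Matrix.of_apply, hnorm] at hx
  rw [hdiff]
  refine le_trans ?_ hx
  refine (Finset.abs_sum_le_sum_abs _ _).trans (Finset.sum_le_sum fun α _ => ?_)
  rw [Finset.mul_sum]
  refine (Finset.abs_sum_le_sum_abs _ _).trans (Finset.sum_le_sum fun β _ => ?_)
  by_cases h : α = β
  · subst h
    simp [hdiag]
  · rw [if_neg h]
    exact (hs α β h).trans_eq (by ring)

end Decorrelation

/-- **N-vector decoupling.** For jointly Gaussian standard Gaussian vectors `Y 1, …, Y N` with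
cross-correlation matrices `R α β`, largest singular values `s α β` (with `s α α = 0`) and `σ₀`
the largest eigenvalue of the matrix `(s α β)`, one has
`(1 - σ₀) ∑ ‖φ α (Y α)‖₂² ≤ ‖∑ φ α (Y α)‖₂² ≤ (1 + σ₀) ∑ ‖φ α (Y α)‖₂²` for all measurable
centered square-integrable `φ α (Y α)`. -/
theorem decoupling_N_gaussian_vectors
    {Ω : Type*} [MeasurableSpace Ω] (μ : Measure Ω) [IsProbabilityMeasure μ]
    {N : ℕ} {d : Fin N → ℕ} (Y : (α : Fin N) → Ω → Fin (d α) → ℝ)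
    (hGauss : IsJointGaussianFamily μ Y)
    (hmean : ∀ α i, ∫ ω, Y α ω i ∂μ = 0)
    (hcov : ∀ α i j, ∫ ω, Y α ω i * Y α ω j ∂μ = if i = j then 1 else 0)
    (R : (α β : Fin N) → Matrix (Fin (d α)) (Fin (d β)) ℝ)
    (hR : ∀ α β, α ≠ β → ∀ i j, R α β i j = ∫ ω, Y α ω i * Y β ω j ∂μ)
    (s : Fin N → Fin N → ℝ)
    (hsdiag : ∀ α, s α α = 0)
    (hs0 : ∀ α β, α ≠ β → 0 ≤ s α β)
    (hsEig : ∀ α β, α ≠ β → ∃ v : Fin (d β) → ℝ, v ≠ 0 ∧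
      ((R α β).transpose * R α β).mulVec v = (s α β) ^ 2 • v)
    (hsMax : ∀ α β, α ≠ β → ∀ (t : ℝ) (v : Fin (d β) → ℝ), v ≠ 0 →
      ((R α β).transpose * R α β).mulVec v = t • v → t ≤ (s α β) ^ 2)
    (σ₀ : ℝ)
    (hσEig : ∃ v : Fin N → ℝ, v ≠ 0 ∧ (Matrix.of s).mulVec v = σ₀ • v)
    (hσMax : ∀ (t : ℝ) (v : Fin N → ℝ), v ≠ 0 → (Matrix.of s).mulVec v = t • v → t ≤ σ₀)
    (φ : (α : Fin N) → (Fin (d α) → ℝ) → ℝ)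
    (hmeas : ∀ α, Measurable (φ α))
    (hcent : ∀ α, ∫ ω, φ α (Y α ω) ∂μ = 0)
    (hL2 : ∀ α, Integrable (fun ω => (φ α (Y α ω)) ^ 2) μ) :
    (1 - σ₀) * ∑ α, ∫ ω, (φ α (Y α ω)) ^ 2 ∂μ ≤ ∫ ω, (∑ α, φ α (Y α ω)) ^ 2 ∂μ ∧
      ∫ ω, (∑ α, φ α (Y α ω)) ^ 2 ∂μ ≤ (1 + σ₀) * ∑ α, ∫ ω, (φ α (Y α ω)) ^ 2 ∂μ := by
  have hL2' : ∀ α, MemLp (fun ω => φ α (Y α ω)) 2 μ := by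
    intro α
    have hYm : AEMeasurable (Y α) μ :=
      (WithLp.measurable_ofLp 2 _).comp_aemeasurable
        ((measurable_pi_apply α).comp_aemeasurable hGauss.hasGaussianLaw.aemeasurable)
    exact (memLp_two_iff_integrable_sq
      ((hmeas α).comp_aemeasurable hYm).aestronglyMeasurable).2 (hL2 α)
  have hRt : ∀ α β, α ≠ β → R β α = (R α β).transpose := by
    intro α β h
    ext i j
    rw [Matrix.transpose_apply, hR α β h, hR β α h.symm]
    simp only [mul_comm]
  have hle : ∀ α β, α ≠ β → s α β ≤ s β α := by
    intro α β h
    refine le_of_transpose_mul_self_eigenvalue (hs0 β α h.symm) (hsEig α β h) ?_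
    simpa [hRt α β h] using hsMax β α h.symm
  have hsymm : ∀ α β, s α β = s β α := by
    intro α β
    rcases eq_or_ne α β with rfl | h
    · rfl
    · exact le_antisymm (hle α β h) (hle β α h.symm)
  have hS : (Matrix.of s).IsHermitian := by
    ext α β
    simp [hsymm α β]
  have hcorr : ∀ α β, α ≠ β → |∫ ω, φ α (Y α ω) * φ β (Y β ω) ∂μ| ≤
      s α β * (√(∫ ω, φ α (Y α ω) ^ 2 ∂μ) * √(∫ ω, φ β (Y β ω) ^ 2 ∂μ)) := by
    intro α β h
    have hn := Matrix.norm_toLpLin_le (hs0 α β h) (hsMax α β h)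
    have hnt := Matrix.norm_toLpLin_le (hs0 β α h.symm) (hsMax β α h.symm)
    rw [hRt α β h, ← hsymm α β] at hnt
    have hpair := hGauss.hasGaussianLaw.map_fun
      ((ContinuousLinearMap.proj (R := ℝ)
          (φ := fun γ : Fin N => EuclideanSpace ℝ (Fin (d γ))) α).prod
        (ContinuousLinearMap.proj (R := ℝ)
          (φ := fun γ : Fin N => EuclideanSpace ℝ (Fin (d γ))) β))
    exact abs_integral_mul_le_of_hasGaussianLaw (s := ⟨s α β, hs0 α β h⟩)
      (X := fun ω => WithLp.toLp 2 (Y α ω)) (Y := fun ω => WithLp.toLp 2 (Y β ω)) hpair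
      (hmean α) (hmean β) (hcov α) (hcov β) (hR α β h) hn hnt
      (h := fun x => φ α x.ofLp) ((hmeas α).comp (WithLp.measurable_ofLp 2 _)) (hL2' α)
      (f := fun x => φ β x.ofLp) ((hmeas β).comp (WithLp.measurable_ofLp 2 _)) (hL2' β) (hcent β)
  have hmain := abs_le.1 (abs_integral_sq_sum_sub_le hL2' hsdiag hcorr
    (hS.dotProduct_mulVec_le hσMax))
  constructor <;> linarith [hmain.1, hmain.2]
end
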